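/- arXiv:1506.03841 — 2 statements merged into one kernel-verified Lean document; each statement's English description precedes it below -/
import Mathlib

section
/- Let F₁(x,y,z) = (y³ − z²x)(y³ + z²x) + (x+y+z)⁷ and F₂(x,y,z) = (y³ − z²x)(y³ + 2z²x) + (x+y+z)⁷, and let X₁, X₂ ⊆ ℂ³ be their zero sets. There is a dense Zariski-open subset Ω ⊆ ℂ³ such that for every (a,b,c) ∈ Ω, setting Πᵢ = Xᵢ ∩ {a·∂Fᵢ/∂x + b·∂Fᵢ/∂y + c·∂Fᵢ/∂z = 0} (the polar curve of the linear projection with kernel direction determined by (a,b,c)), for all sufficiently small ε > 0 the set Π₁ ∩ {p ∈ ℂ³ : 0 < ‖p‖ ≤ ε} has exactly 8 connected components while Π₂ ∩ {p ∈ ℂ³ : 0 < ‖p‖ ≤ ε} has exactly 9 connected components; in particular the generic polar curves of (X₁,0) and (X₂,0) have different numbers of branches. -/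
open scoped Topology

noncomputable section

/-- `ℂ³` with the Euclidean (Hermitian) norm. -/
abbrev C3 := EuclideanSpace ℂ (Fin 3)

open MvPolynomial in
/-- `F₁ = (y³ − z²x)(y³ + z²x) + (x+y+z)⁷`, with `x = X 0`, `y = X 1`, `z = X 2`. -/
def FOne : MvPolynomial (Fin 3) ℂ :=
  (X 1 ^ 3 - X 2 ^ 2 * X 0) * (X 1 ^ 3 + X 2 ^ 2 * X 0) + (X 0 + X 1 + X 2) ^ 7

open MvPolynomial in
/-- `F₂ = (y³ − z²x)(y³ + 2z²x) + (x+y+z)⁷`. -/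
def FTwo : MvPolynomial (Fin 3) ℂ :=
  (X 1 ^ 3 - X 2 ^ 2 * X 0) * (X 1 ^ 3 + 2 * X 2 ^ 2 * X 0) + (X 0 + X 1 + X 2) ^ 7

/-- The polar curve of `{F = 0}` for the linear projection with kernel direction
determined by `(a,b,c)`: `{F = 0} ∩ {a·∂F/∂x + b·∂F/∂y + c·∂F/∂z = 0}`. -/
def polarCurve (F : MvPolynomial (Fin 3) ℂ) (a b c : ℂ) : Set C3 :=
  {p | MvPolynomial.eval (fun i => p i) F = 0 ∧
    a * MvPolynomial.eval (fun i => p i) (MvPolynomial.pderiv 0 F) +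
      b * MvPolynomial.eval (fun i => p i) (MvPolynomial.pderiv 1 F) +
      c * MvPolynomial.eval (fun i => p i) (MvPolynomial.pderiv 2 F) = 0}

/-- The punctured closed ball `{p ∈ ℂ³ : 0 < ‖p‖ ≤ ε}`. -/
def puncturedBall (ε : ℝ) : Set C3 := {p | 0 < ‖p‖ ∧ ‖p‖ ≤ ε}

open Filter Set Topology


lemma card_comp_of_open {X ι : Type*} [TopologicalSpace X] [Fintype ι]
    (S : Set X) (U : ι → Set X) (hU : ∀ i, IsOpen (U i))
    (hd : Pairwise (fun i j => Disjoint (U i) (U j)))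
    (hc : ∀ p ∈ S, ∃ i, p ∈ U i)
    (hn : ∀ i, (S ∩ U i).Nonempty)
    (hp : ∀ i, IsPreconnected (S ∩ U i)) :
    Nat.card (ConnectedComponents ↥S) = Fintype.card ι := by
  classical
  choose pt hpt using hn
  let V : ι → Set S := fun i => Subtype.val ⁻¹' (U i)
  have hVo : ∀ i, IsOpen (V i) := fun i => (hU i).preimage continuous_subtype_val
  have hVd : ∀ i j, i ≠ j → Disjoint (V i) (V j) := fun i j h => (hd h).preimage _
  have hVc : ∀ i, IsClopen (V i) := by
    intro i
    refine ⟨⟨?_⟩, hVo i⟩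
    have : (V i)ᶜ = ⋃ j ∈ {j | j ≠ i}, V j := by
      ext p
      simp only [mem_compl_iff, mem_iUnion, mem_ofPred_eq, exists_prop]
      constructor
      · intro h
        obtain ⟨j, hj⟩ := hc p p.2
        exact ⟨j, fun e => h (e ▸ hj), hj⟩
      · rintro ⟨j, hj, hpj⟩ hpi
        exact (Set.disjoint_left.1 (hVd j i hj)) hpj hpi
    rw [this]
    exact isOpen_biUnion fun j _ => hVo j
  have hVp : ∀ i, IsPreconnected (V i) := by
    intro i
    rw [← IsInducing.subtypeVal.isPreconnected_image]
    have : Subtype.val '' (V i) = S ∩ U i := by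
      simp [V, Subtype.image_preimage_coe]
    rw [this]; exact hp i
  let g : ι → ConnectedComponents S := fun i => ConnectedComponents.mk ⟨pt i, (hpt i).1⟩
  have hg : Function.Bijective g := by
    constructor
    · intro i j hij
      by_contra hne
      have h1 := ConnectedComponents.coe_eq_coe'.1 hij
      have h2 := (hVc j).connectedComponent_subset (x := ⟨pt j, (hpt j).1⟩) (hpt j).2 h1
      exact Set.disjoint_left.1 (hVd i j hne) (hpt i).2 h2
    · intro c
      obtain ⟨p, rfl⟩ := ConnectedComponents.surjective_coe c
      obtain ⟨i, hi⟩ := hc p p.2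
      refine ⟨i, ?_⟩
      apply ConnectedComponents.coe_eq_coe'.2
      exact (hVp i).subset_connectedComponent (x := p) hi (hpt i).2
  rw [← Nat.card_eq_of_bijective g hg, Nat.card_eq_fintype_card]

lemma star_preconn (A : Set ℂ) (h0 : (0:ℂ) ∉ A)
    (hs : ∀ s ∈ A, ∀ τ : ℝ, 0 < τ → τ ≤ 1 → (τ : ℂ) * s ∈ A)
    (ρ : ℝ) (hρ : 0 < ρ) (hA : ∀ s : ℂ, s ≠ 0 → ‖s‖ < ρ → s ∈ A) : IsPreconnected A := by
  have hAe : A = Complex.exp '' (Complex.exp ⁻¹' A) := by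
    rw [Set.image_preimage_eq_inter_range, Complex.range_exp]
    ext s
    simp only [mem_inter_iff, mem_compl_iff, mem_singleton_iff]
    exact ⟨fun h => ⟨h, fun e => h0 (e ▸ h)⟩, fun h => h.1⟩
  rw [hAe]
  refine IsPreconnected.image ?_ _ Complex.continuous_exp.continuousOn
  let H : Set ℂ := {ζ | ζ.re < Real.log ρ}
  have hHA : H ⊆ Complex.exp ⁻¹' A := by
    intro ζ hζ
    refine hA _ (Complex.exp_ne_zero _) ?_
    rw [Complex.norm_exp]
    exact (Real.lt_log_iff_exp_lt hρ).1 hζ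
  have hHc : Convex ℝ H := convex_halfSpace_re_lt _
  refine isPreconnected_of_forall ((Real.log ρ - 1 : ℝ) : ℂ) ?_
  intro y hy
  let T : ℝ := |y.re - Real.log ρ| + 1
  have hT : 0 < T := by positivity
  have hyT : y - T ∈ H := by
    simp only [H, mem_ofPred_eq, Complex.sub_re, Complex.ofReal_re, T]
    have := le_abs_self (y.re - Real.log ρ)
    linarith
  refine ⟨H ∪ segment ℝ y (y - T), ?_, Or.inl ?_, Or.inr (left_mem_segment _ _ _), ?_⟩
  · refine union_subset hHA ?_
    rintro _ ⟨u, v, hu, hv, huv, rfl⟩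
    have : u • y + v • (y - (T:ℂ)) = ((-(v * T) : ℝ) : ℂ) + y := by
      have : (u : ℂ) = 1 - v := by rw [eq_sub_iff_add_eq]; exact_mod_cast huv
      simp only [Complex.real_smul, this]; push_cast; ring
    rw [mem_preimage, this, Complex.exp_add, ← Complex.ofReal_exp]
    refine hs _ hy _ (Real.exp_pos _) (Real.exp_le_one_iff.2 ?_)
    have := mul_nonneg hv hT.le
    linarith
  · simp [H]
  · exact IsPreconnected.union (y - T) hyT (right_mem_segment _ _ _) hHc.isPreconnected
      (convex_segment _ _).isPreconnected

/-- radial monotonicity -/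
lemma radial_mono {E : Type*} [NormedAddCommGroup E] [NormedSpace ℂ E] [CompleteSpace E] (p : ℂ → E)
    (hp : AnalyticAt ℂ p 0) (hp0 : p 0 = 0) (hne : ∀ᶠ s in 𝓝[≠] (0:ℂ), p s ≠ 0) :
    ∃ r > 0, ∀ s : ℂ, ‖s‖ < r → ∀ τ : ℝ, 0 < τ → τ ≤ 1 → ‖p (τ * s)‖ ≤ ‖p s‖ := by
  have h1 : ¬ ∀ᶠ z in 𝓝 (0:ℂ), p z = 0 := by
    intro h
    have h2 : ∀ᶠ z in 𝓝[≠] (0:ℂ), p z = 0 := h.filter_mono nhdsWithin_le_nhds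
    obtain ⟨z, hz, hz'⟩ := (h2.and hne).exists
    exact hz' hz
  obtain ⟨n, g, hg, hg0, hpg⟩ := hp.exists_eventuallyEq_pow_smul_nonzero_iff.2 h1
  have hn : n ≠ 0 := by
    rintro rfl
    have := hpg.self_of_nhds
    rw [hp0] at this
    simp at this
    exact hg0 this.symm
  obtain ⟨K, t, ht, hK⟩ := (hg.contDiffAt (n := 1)).exists_lipschitzOnWith
  have hsmall : ∀ᶠ s in 𝓝 (0:ℂ), (K:ℝ) * ‖s‖ ≤ ‖g s‖ := by
    have c1 : ContinuousAt (fun s : ℂ => ‖g s‖ - (K:ℝ) * ‖s‖) 0 :=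
      (hg.continuousAt.norm).sub (by fun_prop)
    have : ∀ᶠ s in 𝓝 (0:ℂ), 0 < ‖g s‖ - (K:ℝ) * ‖s‖ := by
      apply c1.eventually (lt_mem_nhds _)
      simpa using hg0
    filter_upwards [this] with s hs
    linarith
  obtain ⟨r, hr, hr'⟩ := Metric.eventually_nhds_iff.1 (hpg.and ((eventually_mem_set.2 ht).and hsmall))
  refine ⟨r, hr, fun s hs τ h0 h1 => ?_⟩
  have hs1 := hr' (y := s) (by simpa using hs)
  have hs2 := hr' (y := (τ:ℂ) * s) (by
    simp only [dist_zero_right, norm_mul, Complex.norm_real, Real.norm_eq_abs, abs_of_pos h0]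
    nlinarith [norm_nonneg s])
  rw [hs1.1, hs2.1]
  simp only [sub_zero, norm_smul, norm_pow, norm_mul, Complex.norm_real, Real.norm_eq_abs,
    abs_of_pos h0, mul_pow]
  have hl : ‖g (τ * s)‖ ≤ ‖g s‖ + K * ((1 - τ) * ‖s‖) := by
    have h3 := hK.dist_le_mul _ hs2.2.1 _ hs1.2.1
    have h4 : dist ((τ:ℂ) * s) s = (1 - τ) * ‖s‖ := by
      rw [dist_comm, dist_eq_norm]
      have : s - τ * s = ((1 - τ : ℝ) : ℂ) * s := by push_cast; ring
      rw [this, norm_mul, Complex.norm_real, Real.norm_eq_abs, abs_of_nonneg (by linarith)]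
    rw [h4] at h3
    have h5 : ‖g (τ * s)‖ ≤ ‖g s‖ + dist (g (τ * s)) (g s) := by
      rw [dist_eq_norm]
      have := norm_add_le (g s) (g (τ * s) - g s)
      simpa using this
    linarith
  have hτn : τ ^ n ≤ τ := pow_le_of_le_one h0.le h1 hn
  have hk := hs1.2.2
  have key : τ ^ n * ‖g (τ * s)‖ ≤ ‖g s‖ := by
    calc τ ^ n * ‖g (τ * s)‖ ≤ τ * (‖g s‖ + K * ((1 - τ) * ‖s‖)) := by
          apply mul_le_mul hτn hl (norm_nonneg _) h0.le
      _ = τ * ‖g s‖ + τ * ((1 - τ) * (K * ‖s‖)) := by ring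
      _ ≤ τ * ‖g s‖ + 1 * ((1 - τ) * ‖g s‖) := by
          have : 0 ≤ 1 - τ := by linarith
          have h6 : (1 - τ) * (K * ‖s‖) ≤ (1 - τ) * ‖g s‖ := mul_le_mul_of_nonneg_left hk this
          have h7 : 0 ≤ (1 - τ) * (K * ‖s‖) := by positivity
          nlinarith
      _ = ‖g s‖ := by ring
  calc τ ^ n * ‖s‖ ^ n * ‖g (τ * s)‖ = ‖s‖ ^ n * (τ ^ n * ‖g (τ * s)‖) := by ring
    _ ≤ ‖s‖ ^ n * ‖g s‖ := mul_le_mul_of_nonneg_left key (by positivity)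

lemma card_comp_abstract {E ι : Type*} [NormedAddCommGroup E] [NormedSpace ℂ E] [CompleteSpace E] [Fintype ι]
    (S : Set E) (p : ι → ℂ → E) (U : ι → Set E)
    (hp : ∀ i, AnalyticAt ℂ (p i) 0) (hp0 : ∀ i, p i 0 = 0)
    (hne : ∀ i, ∀ᶠ s in 𝓝[≠] (0:ℂ), p i s ≠ 0)
    (hU : ∀ i, IsOpen (U i)) (hd : Pairwise (fun i j => Disjoint (U i) (U j)))
    (hm : ∀ i, ∀ᶠ s in 𝓝[≠] (0:ℂ), p i s ∈ S ∩ U i)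
    (hc : ∀ r > 0, ∀ᶠ x in 𝓝[≠] (0:E), x ∈ S → ∃ i, ∃ s : ℂ, s ≠ 0 ∧ ‖s‖ < r ∧ x = p i s) :
    ∃ ε₀ > (0:ℝ), ∀ ε : ℝ, 0 < ε → ε ≤ ε₀ →
      Nat.card (ConnectedComponents ↥(S ∩ {x | 0 < ‖x‖ ∧ ‖x‖ ≤ ε})) = Fintype.card ι := by
  have hloc : ∀ i, ∃ r > 0, ∀ s : ℂ, ‖s‖ < r → ContinuousAt (p i) s ∧
      (s ≠ 0 → p i s ≠ 0 ∧ p i s ∈ S ∩ U i) ∧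
      ∀ τ : ℝ, 0 < τ → τ ≤ 1 → ‖p i (τ * s)‖ ≤ ‖p i s‖ := by
    intro i
    obtain ⟨r1, hr1, h1⟩ := radial_mono (p i) (hp i) (hp0 i) (hne i)
    have h2 := eventually_nhdsWithin_iff.1 ((hne i).and (hm i))
    have h3 := (hp i).eventually_analyticAt
    obtain ⟨r2, hr2, h4⟩ := Metric.eventually_nhds_iff.1 (h2.and h3)
    refine ⟨min r1 r2, lt_min hr1 hr2, fun s hs => ?_⟩
    have h5 := h4 (y := s) (by simpa using lt_of_lt_of_le hs (min_le_right _ _))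
    exact ⟨h5.2.continuousAt, fun h0 => h5.1 h0, h1 s (lt_of_lt_of_le hs (min_le_left _ _))⟩
  choose r hr hR using hloc
  obtain ⟨R, hR0, hRr⟩ : ∃ R > 0, ∀ i, R ≤ r i := by
    by_cases hι : Nonempty ι
    · refine ⟨Finset.univ.inf' Finset.univ_nonempty r, ?_, fun i => Finset.inf'_le _ (Finset.mem_univ i)⟩
      simpa [Finset.lt_inf'_iff] using hr
    · exact ⟨1, one_pos, fun i => (hι ⟨i⟩).elim⟩
  obtain ⟨δ, hδ, hcov⟩ := Metric.eventually_nhds_iff.1 (eventually_nhdsWithin_iff.1 (hc R hR0))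
  refine ⟨δ / 2, half_pos hδ, fun ε hε hεδ => ?_⟩
  have hcov' : ∀ x ∈ S ∩ {x | 0 < ‖x‖ ∧ ‖x‖ ≤ ε}, ∃ i, ∃ s : ℂ, s ≠ 0 ∧ ‖s‖ < R ∧ x = p i s := by
    intro x hx
    refine hcov (y := x) ?_ ?_ hx.1
    · have := hx.2.2
      simp only [dist_zero_right]; linarith
    · simpa using hx.2.1
  let A : ι → Set ℂ := fun i => {s | s ≠ 0 ∧ ‖s‖ < R ∧ ‖p i s‖ ≤ ε}
  have hR' : ∀ i (s : ℂ), ‖s‖ < R → ContinuousAt (p i) s ∧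
      (s ≠ 0 → p i s ≠ 0 ∧ p i s ∈ S ∩ U i) ∧
      ∀ τ : ℝ, 0 < τ → τ ≤ 1 → ‖p i (τ * s)‖ ≤ ‖p i s‖ :=
    fun i s hs => hR i s (lt_of_lt_of_le hs (hRr i))
  have himg : ∀ i, S ∩ {x | 0 < ‖x‖ ∧ ‖x‖ ≤ ε} ∩ U i = p i '' A i := by
    intro i
    ext x
    constructor
    · rintro ⟨hx, hxU⟩
      obtain ⟨j, s, hs0, hsR, rfl⟩ := hcov' x hx
      have hj := ((hR' j s hsR).2.1 hs0).2.2
      have : j = i := by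
        by_contra hne
        exact Set.disjoint_left.1 (hd hne) hj hxU
      subst this
      exact ⟨s, ⟨hs0, hsR, hx.2.2⟩, rfl⟩
    · rintro ⟨s, ⟨hs0, hsR, hsε⟩, rfl⟩
      have h := (hR' i s hsR).2.1 hs0
      exact ⟨⟨h.2.1, norm_pos_iff.2 h.1, hsε⟩, h.2.2⟩
  have hball : ∀ i, ∃ ρ > 0, ∀ s : ℂ, s ≠ 0 → ‖s‖ < ρ → s ∈ A i := by
    intro i
    have hcont : ∀ᶠ s in 𝓝 (0:ℂ), ‖p i s‖ < ε := by
      have := (hp i).continuousAt.norm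
      apply this.eventually (gt_mem_nhds _)
      simpa [hp0 i] using hε
    obtain ⟨ρ, hρ, h⟩ := Metric.eventually_nhds_iff.1 hcont
    refine ⟨min ρ R, lt_min hρ hR0, fun s hs0 hs => ⟨hs0, lt_of_lt_of_le hs (min_le_right _ _), ?_⟩⟩
    exact (h (by simpa using lt_of_lt_of_le hs (min_le_left _ _))).le
  refine card_comp_of_open _ U hU hd ?_ ?_ ?_
  · intro x hx
    obtain ⟨i, s, hs0, hsR, rfl⟩ := hcov' x hx
    exact ⟨i, ((hR' i s hsR).2.1 hs0).2.2⟩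
  · intro i
    rw [himg]
    obtain ⟨ρ, hρ, h⟩ := hball i
    refine Set.Nonempty.image _ ⟨((ρ / 2 : ℝ) : ℂ), h _ ?_ ?_⟩
    · exact_mod_cast (half_pos hρ).ne'
    · rw [Complex.norm_real, Real.norm_eq_abs, abs_of_pos (half_pos hρ)]; linarith
  · intro i
    rw [himg]
    obtain ⟨ρ, hρ, h⟩ := hball i
    refine IsPreconnected.image ?_ _ (fun s hs => (hR' i s hs.2.1).1.continuousWithinAt)
    refine star_preconn (A i) (fun h => h.1 rfl) ?_ ρ hρ h
    rintro s ⟨hs0, hsR, hsε⟩ τ h0 h1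
    refine ⟨mul_ne_zero (by exact_mod_cast h0.ne') hs0, ?_, ((hR' i s hsR).2.2 τ h0 h1).trans hsε⟩
    simp only [norm_mul, Complex.norm_real, Real.norm_eq_abs, abs_of_pos h0]
    nlinarith [norm_nonneg s]

def fP (l x y z : ℂ) : ℂ := (y ^ 3 - z ^ 2 * x) * (y ^ 3 + l * z ^ 2 * x)
def dP (l a b c x y z : ℂ) : ℂ :=
  3 * b * y ^ 2 * (2 * y ^ 3 + (l - 1) * z ^ 2 * x) +
    (a * z ^ 2 + 2 * c * z * x) * ((l - 1) * y ^ 3 - 2 * l * z ^ 2 * x)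
def gP (l a b c x y z : ℂ) : ℂ :=
  (x + y + z) * dP l a b c x y z - 7 * (a + b + c) * fP l x y z

def Pol (l a b c : ℂ) : Set C3 :=
  {p | fP l (p 0) (p 1) (p 2) + (p 0 + p 1 + p 2) ^ 7 = 0 ∧
    dP l a b c (p 0) (p 1) (p 2) + 7 * (a + b + c) * (p 0 + p 1 + p 2) ^ 6 = 0}

lemma polar_one (a b c : ℂ) : polarCurve FOne a b c = Pol 1 a b c := by
  ext p
  simp only [polarCurve, Pol, FOne, fP, dP, mem_ofPred_eq]
  simp [MvPolynomial.pderiv_X, Derivation.leibniz, Derivation.leibniz_pow]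
  intro _
  constructor <;> intro h <;> rw [← h] <;> ring

lemma polar_two (a b c : ℂ) : polarCurve FTwo a b c = Pol 2 a b c := by
  have h2 : (2 : MvPolynomial (Fin 3) ℂ) = MvPolynomial.C 2 := (map_ofNat MvPolynomial.C 2).symm
  ext p
  simp only [polarCurve, Pol, FTwo, fP, dP, mem_ofPred_eq]
  rw [h2]
  simp [MvPolynomial.pderiv_X, Derivation.leibniz, Derivation.leibniz_pow]
  intro _
  constructor <;> intro h <;> rw [← h] <;> ring

structure Br (l a b c : ℂ) (q : ℂ → C3) : Prop where
  an : AnalyticAt ℂ q 0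
  L0 : q 0 0 + q 0 1 + q 0 2 ≠ 0
  f0 : fP l (q 0 0) (q 0 1) (q 0 2) = 0
  ev : ∀ᶠ s in 𝓝[≠] (0:ℂ), fP l (q s 0) (q s 1) (q s 2) ≠ 0 ∧
    gP l a b c (q s 0) (q s 1) (q s 2) = 0

def Cov {ι : Type*} (l a b c : ℂ) (q : ι → ℂ → C3) (n : C3) : Prop :=
  ∀ r > 0, ∀ᶠ p : C3 in 𝓝 n, gP l a b c (p 0) (p 1) (p 2) = 0 → fP l (p 0) (p 1) (p 2) ≠ 0 →
    ∃ i, ∃ s : ℂ, s ≠ 0 ∧ ‖s‖ < r ∧ ∃ κ : ℂ, κ ≠ 0 ∧ p = κ • q i s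

lemma main2 {ι : Type*} [Fintype ι] (l a b c : ℂ) (q : ι → ℂ → C3) (U : ι → Set C3)
    (hq : ∀ i, Br l a b c (q i))
    (hU : ∀ i, IsOpen (U i)) (hd : Pairwise (fun i j => Disjoint (U i) (U j)))
    (hcone : ∀ i, ∀ p ∈ U i, ∀ t : ℂ, t ≠ 0 → t • p ∈ U i)
    (hqU : ∀ i, ∀ᶠ s in 𝓝[≠] (0:ℂ), q i s ∈ U i)
    (hL0 : ∀ n : C3, n ≠ 0 → fP l (n 0) (n 1) (n 2) = 0 → dP l a b c (n 0) (n 1) (n 2) = 0 →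
      n 0 + n 1 + n 2 ≠ 0)
    (hc : ∀ n : C3, n ≠ 0 → fP l (n 0) (n 1) (n 2) = 0 → dP l a b c (n 0) (n 1) (n 2) = 0 →
      Cov l a b c q n) :
    ∃ ε₀ > (0:ℝ), ∀ ε : ℝ, 0 < ε → ε ≤ ε₀ →
      Nat.card (ConnectedComponents ↥(Pol l a b c ∩ puncturedBall ε)) = Fintype.card ι := by
  let Lq : ι → ℂ → ℂ := fun i s => q i s 0 + q i s 1 + q i s 2
  let t : ι → ℂ → ℂ := fun i s => - fP l (q i s 0) (q i s 1) (q i s 2) / (Lq i s) ^ 7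
  have hco : ∀ i (j : Fin 3), AnalyticAt ℂ (fun s => q i s j) 0 := by
    intro i j
    exact ((EuclideanSpace.proj j : C3 →L[ℂ] ℂ).analyticAt _).comp (hq i).an
  have hLa : ∀ i, AnalyticAt ℂ (Lq i) 0 := fun i => ((hco i 0).add (hco i 1)).add (hco i 2)
  have hta : ∀ i, AnalyticAt ℂ (t i) 0 := by
    intro i
    have h0 := hco i 0
    have h1 := hco i 1
    have h2 := hco i 2
    have hL := hLa i
    have : (Lq i 0) ^ 7 ≠ 0 := pow_ne_zero _ (hq i).L0
    simp only [t, fP]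
    refine AnalyticAt.div ?_ (hL.pow 7) this
    fun_prop
  have hLne : ∀ i, ∀ᶠ s in 𝓝 (0:ℂ), Lq i s ≠ 0 := fun i =>
    (hLa i).continuousAt.eventually_ne (hq i).L0
  refine card_comp_abstract (Pol l a b c) (fun i s => t i s • q i s) U ?_ ?_ ?_ hU hd ?_ ?_
  · intro i
    exact (hta i).smul (hq i).an
  · intro i
    simp [t, (hq i).f0]
  · intro i
    filter_upwards [(hq i).ev, (hLne i).filter_mono nhdsWithin_le_nhds] with s h1 h2
    refine smul_ne_zero ?_ ?_
    · exact div_ne_zero (neg_ne_zero.2 h1.1) (pow_ne_zero _ h2)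
    · intro h
      apply h2
      simp [Lq, h]
  · intro i
    filter_upwards [(hq i).ev, (hLne i).filter_mono nhdsWithin_le_nhds, hqU i] with s h1 h2 h3
    have ht : t i s ≠ 0 := div_ne_zero (neg_ne_zero.2 h1.1) (pow_ne_zero _ h2)
    refine ⟨?_, hcone i _ h3 _ ht⟩
    have htL : fP l (q i s 0) (q i s 1) (q i s 2) = - t i s * Lq i s ^ 7 := by
      simp only [t]; field_simp
    have hdL : dP l a b c (q i s 0) (q i s 1) (q i s 2) = -(7 * (a + b + c)) * (t i s * Lq i s ^ 6) := by
      have := h1.2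
      simp only [gP, htL] at this
      apply mul_left_cancel₀ h2
      simp only [Lq] at this ⊢
      linear_combination this
    simp only [Pol, mem_ofPred_eq, PiLp.smul_apply, smul_eq_mul]
    constructor
    · have : fP l (t i s * q i s 0) (t i s * q i s 1) (t i s * q i s 2) =
        (t i s) ^ 6 * fP l (q i s 0) (q i s 1) (q i s 2) := by simp only [fP]; ring
      rw [this, htL]
      simp only [Lq]; ring
    · have : dP l a b c (t i s * q i s 0) (t i s * q i s 1) (t i s * q i s 2) =
        (t i s) ^ 5 * dP l a b c (q i s 0) (q i s 1) (q i s 2) := by simp only [dP]; ring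
      rw [this, hdL]
      simp only [Lq]; ring
  · intro r hr
    -- choose a smaller radius
    obtain ⟨r', hr', hrr, hL⟩ : ∃ r' > 0, r' ≤ r ∧ ∀ i (s : ℂ), ‖s‖ < r' → Lq i s ≠ 0 := by
      have : ∀ᶠ s in 𝓝 (0:ℂ), ∀ i, Lq i s ≠ 0 := eventually_all.2 hLne
      obtain ⟨ρ, hρ, h⟩ := Metric.eventually_nhds_iff.1 this
      exact ⟨min ρ r, lt_min hρ hr, min_le_right _ _, fun i s hs =>
        h (by simpa using lt_of_lt_of_le hs (min_le_left _ _)) i⟩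
    have hK : IsCompact (Metric.sphere (0:C3) 1) := isCompact_sphere _ _
    have key := hK.eventually_forall_of_forall_eventually (x₀ := (0:ℂ))
      (P := fun τ n => τ ≠ 0 → τ • n ∈ Pol l a b c →
        ∃ i, ∃ s : ℂ, s ≠ 0 ∧ ‖s‖ < r ∧ τ • n = t i s • q i s) ?_
    · have hn : Tendsto (fun x : C3 => ((‖x‖ : ℝ) : ℂ)) (𝓝[≠] 0) (𝓝 0) := by
        have : Continuous (fun x : C3 => ((‖x‖ : ℝ) : ℂ)) := by fun_prop
        have h := this.tendsto 0
        simp only [norm_zero, Complex.ofReal_zero] at h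
        exact h.mono_left nhdsWithin_le_nhds
      filter_upwards [hn.eventually key, self_mem_nhdsWithin] with x hx hx0 hxS
      have hx0' : x ≠ 0 := hx0
      have hnn : ((‖x‖ : ℝ) : ℂ) ≠ 0 := by exact_mod_cast norm_ne_zero_iff.2 hx0'
      have e : ((‖x‖ : ℝ) : ℂ) • (((‖x‖ : ℝ) : ℂ)⁻¹ • x) = x := smul_inv_smul₀ hnn x
      have := hx (((‖x‖ : ℝ) : ℂ)⁻¹ • x) (by simp [norm_smul, hx0']) hnn
      rw [e] at this
      exact this hxS
    · intro n hn
      have hn0 : n ≠ 0 := by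
        rintro rfl; simp at hn
      have hpol : ∀ (τ : ℂ) (y : C3), τ ≠ 0 → τ • y ∈ Pol l a b c →
          fP l (y 0) (y 1) (y 2) + τ * (y 0 + y 1 + y 2) ^ 7 = 0 ∧
          dP l a b c (y 0) (y 1) (y 2) + τ * (7 * (a + b + c)) * (y 0 + y 1 + y 2) ^ 6 = 0 := by
        intro τ y hτ h
        simp only [Pol, mem_ofPred_eq, PiLp.smul_apply, smul_eq_mul] at h
        constructor
        · apply mul_left_cancel₀ (pow_ne_zero 6 hτ)
          rw [mul_zero, ← h.1]
          simp only [fP]; ring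
        · apply mul_left_cancel₀ (pow_ne_zero 5 hτ)
          rw [mul_zero, ← h.2]
          simp only [dP]; ring
      by_cases hf : fP l (n 0) (n 1) (n 2) = 0
      · by_cases hdd : dP l a b c (n 0) (n 1) (n 2) = 0
        · have hcv := hc n hn0 hf hdd r' hr'
          have hcv2 : ∀ᶠ z : ℂ × C3 in 𝓝 (0, n), _ := (continuous_snd.tendsto ((0:ℂ), n)).eventually hcv
          have hne2 : ∀ᶠ z : ℂ × C3 in 𝓝 (0, n), z.2 ≠ 0 :=
            (continuous_snd.continuousAt (x := ((0:ℂ), n))).eventually_ne hn0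
          filter_upwards [hcv2, hne2] with z hz hzn hz0 hzP
          obtain ⟨h1, h2⟩ := hpol z.1 z.2 hz0 hzP
          have hg : gP l a b c (z.2 0) (z.2 1) (z.2 2) = 0 := by
            simp only [gP]
            linear_combination (z.2 0 + z.2 1 + z.2 2) * h2 - 7 * (a + b + c) * h1
          by_cases hfz : fP l (z.2 0) (z.2 1) (z.2 2) = 0
          · exfalso
            have hLz : z.2 0 + z.2 1 + z.2 2 = 0 := by
              rw [hfz, zero_add] at h1
              exact pow_eq_zero_iff (by norm_num) |>.1 ((mul_eq_zero.1 h1).resolve_left hz0)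
            refine hL0 z.2 hzn hfz ?_ hLz
            rw [hLz] at h2
            simpa using h2
          · obtain ⟨i, s, hs0, hs, κ, hκ, hzq⟩ := hz hg hfz
            refine ⟨i, s, hs0, lt_of_lt_of_le hs hrr, ?_⟩
            have hLs := hL i s hs
            rw [hzq, smul_smul]
            congr 1
            rw [hzq] at h1
            simp only [PiLp.smul_apply, smul_eq_mul] at h1
            simp only [t]
            rw [eq_div_iff (pow_ne_zero _ hLs)]
            apply mul_left_cancel₀ (pow_ne_zero 6 hκ)
            simp only [Lq, fP] at h1 ⊢
            linear_combination h1
        · have : ∀ᶠ z : ℂ × C3 in 𝓝 (0, n), dP l a b c (z.2 0) (z.2 1) (z.2 2) + z.1 * (7 * (a + b + c)) * (z.2 0 + z.2 1 + z.2 2) ^ 6 ≠ 0 := by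
            refine ContinuousAt.eventually_ne (Continuous.continuousAt ?_) ?_
            · simp only [dP]; fun_prop
            · simpa using hdd
          filter_upwards [this] with z hz hz0 hzP
          exact absurd (hpol z.1 z.2 hz0 hzP).2 hz
      · have : ∀ᶠ z : ℂ × C3 in 𝓝 (0, n), fP l (z.2 0) (z.2 1) (z.2 2) + z.1 * (z.2 0 + z.2 1 + z.2 2) ^ 7 ≠ 0 := by
          refine ContinuousAt.eventually_ne (Continuous.continuousAt ?_) ?_
          · simp only [fP]; fun_prop
          · simpa using hf
        filter_upwards [this] with z hz hz0 hzP
        exact absurd (hpol z.1 z.2 hz0 hzP).1 hz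


lemma tend_of_cont {X Y : Type*} [TopologicalSpace X] [TopologicalSpace Y] {f : X → Y} {x : X} {y : Y}
    (hc : ContinuousAt f x) (e : f x = y) : Tendsto f (𝓝 x) (𝓝 y) := e ▸ hc

lemma ift2 (H : ℂ × ℂ → ℂ) (z0 D : ℂ) (hH : ContDiff ℂ ⊤ H) (h0 : H (0, z0) = 0)
    (hD : HasDerivAt (fun z => H (0, z)) D z0) (hD0 : D ≠ 0) :
    ∃ ψ : ℂ → ℂ, AnalyticAt ℂ ψ 0 ∧ ψ 0 = z0 ∧ (∀ᶠ s in 𝓝 (0:ℂ), H (s, ψ s) = 0) ∧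
      ∀ᶠ v in 𝓝 ((0:ℂ), z0), H v = 0 → v.2 = ψ v.1 := by
  have cdf : ContDiffAt ℂ ⊤ H (0, z0) := hH.contDiffAt
  have hn : (⊤ : WithTop ℕ∞) ≠ 0 := by simp
  have hfd : HasFDerivAt H (fderiv ℂ H (0, z0)) (0, z0) :=
    (cdf.differentiableAt hn).hasFDerivAt
  have hpart : (fderiv ℂ H (0, z0) ∘L .inr ℂ ℂ ℂ) 1 = D := by
    have h1 : HasDerivAt (fun z : ℂ => ((0:ℂ), z)) (0, 1) z0 :=
      (hasDerivAt_const z0 (0:ℂ)).prodMk (hasDerivAt_id z0)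
    have h2 := (hfd.comp_hasDerivAt z0 h1)
    have := h2.unique hD
    simpa using this
  have hinv : (fderiv ℂ H (0, z0) ∘L .inr ℂ ℂ ℂ).IsInvertible := by
    refine ⟨ContinuousLinearEquiv.unitsEquivAut ℂ (Units.mk0 D hD0), ?_⟩
    ext
    simp only [ContinuousLinearEquiv.coe_coe, ContinuousLinearEquiv.unitsEquivAut_apply]
    rw [hpart]; simp
  refine ⟨cdf.implicitFunction hn hinv, ?_, cdf.implicitFunction_apply_self hn hinv, ?_, ?_⟩
  · exact (cdf.contDiffAt_implicitFunction hn hinv).analyticAt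
  · have := cdf.eventually_apply_implicitFunction hn hinv
    rwa [h0] at this
  · have := cdf.eventually_apply_eq_iff_implicitFunction hn hinv
    filter_upwards [this] with v hv h
    rw [h0] at hv
    exact (hv.1 h).symm

def mk3 (x y z : ℂ) : C3 := !₂[x, y, z]
@[simp] lemma mk3_0 (x y z : ℂ) : mk3 x y z 0 = x := by simp [mk3]
@[simp] lemma mk3_1 (x y z : ℂ) : mk3 x y z 1 = y := by simp [mk3]
@[simp] lemma mk3_2 (x y z : ℂ) : mk3 x y z 2 = z := by simp [mk3]

lemma mk3_an {x y z : ℂ → ℂ} (hx : AnalyticAt ℂ x 0) (hy : AnalyticAt ℂ y 0)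
    (hz : AnalyticAt ℂ z 0) : AnalyticAt ℂ (fun s => mk3 (x s) (y s) (z s)) 0 := by
  have h : (fun s => mk3 (x s) (y s) (z s)) = fun s =>
      x s • mk3 1 0 0 + y s • mk3 0 1 0 + z s • mk3 0 0 1 := by
    funext s
    ext i
    fin_cases i <;> simp [mk3]
  rw [h]
  fun_prop

def CovZ (l a b c : ℂ) (q : ℂ → C3) (X Y : ℂ) : Prop :=
  ∀ r > 0, ∀ᶠ v : ℂ × ℂ in 𝓝 (X, Y), gP l a b c v.1 v.2 1 = 0 → fP l v.1 v.2 1 ≠ 0 →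
    ∃ s : ℂ, s ≠ 0 ∧ ‖s‖ < r ∧ mk3 v.1 v.2 1 = q s

lemma cov_of_z {ι : Type*} (l a b c : ℂ) (q : ι → ℂ → C3) (n : C3) (hn : n 2 ≠ 0) (i : ι)
    (h : CovZ l a b c (q i) (n 0 / n 2) (n 1 / n 2)) : Cov l a b c q n := by
  intro r hr
  have hc : ContinuousAt (fun p : C3 => (p 0 / p 2, p 1 / p 2)) n := by
    refine ContinuousAt.prodMk ?_ ?_ <;> refine ContinuousAt.div ?_ ?_ hn <;>
      exact Continuous.continuousAt (by fun_prop)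
  have hne : ∀ᶠ p : C3 in 𝓝 n, p 2 ≠ 0 :=
    (Continuous.continuousAt (by fun_prop : Continuous fun p : C3 => p 2)).eventually_ne hn
  filter_upwards [hc.eventually (h r hr), hne] with p hp hp2 hg hf
  have e1 : gP l a b c (p 0 / p 2) (p 1 / p 2) 1 = gP l a b c (p 0) (p 1) (p 2) / p 2 ^ 6 := by
    simp only [gP, dP, fP]; field_simp
  have e2 : fP l (p 0 / p 2) (p 1 / p 2) 1 = fP l (p 0) (p 1) (p 2) / p 2 ^ 6 := by
    simp only [fP]; field_simp
  obtain ⟨s, hs0, hs, hq⟩ := hp (by rw [e1, hg, zero_div])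
    (by rw [e2]; exact div_ne_zero hf (pow_ne_zero _ hp2))
  refine ⟨i, s, hs0, hs, p 2, hp2, ?_⟩
  rw [← hq]
  ext j
  fin_cases j <;> simp [mk3] <;> field_simp

lemma cov_of_x {ι : Type*} (l a b c : ℂ) (q : ι → ℂ → C3) (n : C3) (hn : n 0 ≠ 0)
    (h : ∀ r > 0, ∀ᶠ v : ℂ × ℂ in 𝓝 (n 1 / n 0, n 2 / n 0), gP l a b c 1 v.1 v.2 = 0 →
      fP l 1 v.1 v.2 ≠ 0 → ∃ i, ∃ s : ℂ, s ≠ 0 ∧ ‖s‖ < r ∧ mk3 1 v.1 v.2 = q i s) :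
    Cov l a b c q n := by
  intro r hr
  have hc : ContinuousAt (fun p : C3 => (p 1 / p 0, p 2 / p 0)) n := by
    refine ContinuousAt.prodMk ?_ ?_ <;> refine ContinuousAt.div ?_ ?_ hn <;>
      exact Continuous.continuousAt (by fun_prop)
  have hne : ∀ᶠ p : C3 in 𝓝 n, p 0 ≠ 0 :=
    (Continuous.continuousAt (by fun_prop : Continuous fun p : C3 => p 0)).eventually_ne hn
  filter_upwards [hc.eventually (h r hr), hne] with p hp hp2 hg hf
  have e1 : gP l a b c 1 (p 1 / p 0) (p 2 / p 0) = gP l a b c (p 0) (p 1) (p 2) / p 0 ^ 6 := by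
    simp only [gP, dP, fP]; field_simp
  have e2 : fP l 1 (p 1 / p 0) (p 2 / p 0) = fP l (p 0) (p 1) (p 2) / p 0 ^ 6 := by
    simp only [fP]; field_simp
  obtain ⟨i, s, hs0, hs, hq⟩ := hp (by rw [e1, hg, zero_div])
    (by rw [e2]; exact div_ne_zero hf (pow_ne_zero _ hp2))
  refine ⟨i, s, hs0, hs, p 0, hp2, ?_⟩
  rw [← hq]
  ext j
  fin_cases j <;> simp [mk3] <;> field_simp

def hW (l a b c w Y : ℂ) : ℂ :=
  (1 + Y + Y ^ 3 * w) * (3 * b * Y ^ 2 * (2 + (l - 1) * w) +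
    (a + 2 * c * w * Y ^ 3) * ((l - 1) - 2 * l * w)) - 7 * (a + b + c) * Y ^ 3 * ((1 - w) * (1 + l * w))

lemma gP_hW (l a b c w Y : ℂ) : gP l a b c (Y ^ 3 * w) Y 1 = Y ^ 3 * hW l a b c w Y := by
  simp only [gP, dP, fP, hW]; ring
lemma fP_hW (l w Y : ℂ) : fP l (Y ^ 3 * w) Y 1 = Y ^ 6 * ((1 - w) * (1 + l * w)) := by
  simp only [fP]; ring

lemma branchA (l a b c w0 Y0 α β : ℂ) (hY : Y0 ≠ 0)
    (hw : ∀ w, (1 - w) * (1 + l * w) = (w - w0) * (α + β * w)) (hαβ : α + β * w0 ≠ 0)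
    (hE : 3 * b * Y0 ^ 2 * (2 + (l - 1) * w0) +
      (a + 2 * c * w0 * Y0 ^ 3) * ((l - 1) - 2 * l * w0) = 0)
    (hE' : 6 * b * Y0 * (2 + (l - 1) * w0) + 6 * c * w0 * Y0 ^ 2 * ((l - 1) - 2 * l * w0) ≠ 0)
    (hL : 1 + Y0 + Y0 ^ 3 * w0 ≠ 0) :
    ∃ q : ℂ → C3, Br l a b c q ∧ q 0 = mk3 (Y0 ^ 3 * w0) Y0 1 ∧
      CovZ l a b c q (Y0 ^ 3 * w0) Y0 := by
  obtain ⟨ψ, hψa, hψ0, hψ1, hψ2⟩ := ift2 (fun v => hW l a b c (w0 + v.1) v.2) Y0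
    ((1 + Y0 + Y0 ^ 3 * w0) * (6 * b * Y0 * (2 + (l - 1) * w0) + 6 * c * w0 * Y0 ^ 2 * ((l - 1) - 2 * l * w0)))
    (by simp only [hW]; fun_prop)
    (by simp only [hW, add_zero, hE, hw]; simp)
    (by
      simp only [hW, add_zero, hw, sub_self, zero_mul, mul_zero, sub_zero]
      have h1 : HasDerivAt (fun z : ℂ => 1 + z + z ^ 3 * w0) (1 + 3 * Y0 ^ 2 * w0) Y0 := by
        have := ((hasDerivAt_id' Y0).const_add 1).add ((hasDerivAt_pow 3 Y0).mul_const w0)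
        convert! this using 1
      have h2 : HasDerivAt (fun z : ℂ => 3 * b * z ^ 2 * (2 + (l - 1) * w0) +
          (a + 2 * c * w0 * z ^ 3) * ((l - 1) - 2 * l * w0))
          (6 * b * Y0 * (2 + (l - 1) * w0) + 6 * c * w0 * Y0 ^ 2 * ((l - 1) - 2 * l * w0)) Y0 := by
        have := (((hasDerivAt_pow 2 Y0).const_mul (3 * b)).mul_const (2 + (l - 1) * w0)).add
          ((((hasDerivAt_pow 3 Y0).const_mul (2 * c * w0)).const_add a).mul_const ((l - 1) - 2 * l * w0))
        convert! this using 1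
        push_cast; ring
      have := h1.mul h2
      rw [hE, mul_zero, zero_add] at this
      exact this) (mul_ne_zero hL hE')
  refine ⟨fun s => mk3 (ψ s ^ 3 * (w0 + s)) (ψ s) 1, ⟨?_, ?_, ?_, ?_⟩, ?_, ?_⟩
  · exact mk3_an (by fun_prop) hψa (by fun_prop)
  · simp only [mk3_0, mk3_1, mk3_2, hψ0, add_zero]
    intro h; apply hL; linear_combination h
  · simp only [mk3_0, mk3_1, mk3_2, hψ0, add_zero, fP_hW, hw]; simp
  · have c1 : ∀ᶠ s in 𝓝 (0:ℂ), ψ s ≠ 0 := hψa.continuousAt.eventually_ne (by rwa [hψ0])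
    have c2 : ∀ᶠ s in 𝓝 (0:ℂ), α + β * (w0 + s) ≠ 0 :=
      (Continuous.continuousAt (by fun_prop)).eventually_ne (by simpa using hαβ)
    filter_upwards [c1.filter_mono nhdsWithin_le_nhds, c2.filter_mono nhdsWithin_le_nhds,
      hψ1.filter_mono nhdsWithin_le_nhds, self_mem_nhdsWithin] with s h1 h2 h3 h4
    simp only [mk3_0, mk3_1, mk3_2]
    rw [fP_hW, gP_hW, h3, hw]
    refine ⟨mul_ne_zero (pow_ne_zero _ h1) (mul_ne_zero ?_ h2), mul_zero _⟩
    simpa using h4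
  · simp [hψ0]
  · intro r hr
    have hc : ContinuousAt (fun v : ℂ × ℂ => (v.1 / v.2 ^ 3 - w0, v.2)) (Y0 ^ 3 * w0, Y0) := by
      refine ContinuousAt.prodMk (ContinuousAt.sub (ContinuousAt.div ?_ ?_ (by simpa using hY))
        continuousAt_const) ?_ <;> exact Continuous.continuousAt (by fun_prop)
    have e0 : (fun v : ℂ × ℂ => (v.1 / v.2 ^ 3 - w0, v.2)) (Y0 ^ 3 * w0, Y0) = (0, Y0) := by
      simp only [Prod.mk.injEq, and_true]; field_simp; ring
    replace hc := tend_of_cont hc e0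
    have hne : ∀ᶠ v : ℂ × ℂ in 𝓝 (Y0 ^ 3 * w0, Y0), v.2 ≠ 0 :=
      (continuous_snd.continuousAt).eventually_ne hY
    have hball : ∀ᶠ v : ℂ × ℂ in 𝓝 ((0:ℂ), Y0), ‖v.1‖ < r := by
      apply (Continuous.continuousAt (by fun_prop : Continuous fun v : ℂ × ℂ => ‖v.1‖)).eventually
        (gt_mem_nhds _)
      simpa using hr
    filter_upwards [hc.eventually hψ2, hc.eventually hball, hne] with v h1 h2 h3 hg hf
    have ev : v.1 = v.2 ^ 3 * (w0 + (v.1 / v.2 ^ 3 - w0)) := by field_simp; ring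
    refine ⟨v.1 / v.2 ^ 3 - w0, ?_, h2, ?_⟩
    · intro h
      rw [ev, fP_hW, h, hw] at hf
      simp at hf
    · rw [ev, gP_hW] at hg
      have := h1 ((mul_eq_zero.1 hg).resolve_left (pow_ne_zero _ h3))
      rw [← this, ← ev]

lemma branchB (l a b c : ℂ) (ha : a ≠ 0) (hl : l ≠ 0) (hl1 : l + 1 ≠ 0) :
    ∃ q : ℂ → C3, Br l a b c q ∧ q 0 = mk3 0 0 1 ∧ CovZ l a b c q 0 0 := by
  set w0 : ℂ := (l - 1) / (2 * l) with hw0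
  obtain ⟨ψ, hψa, hψ0, hψ1, hψ2⟩ := ift2 (fun v => hW l a b c v.2 v.1) w0 (-2 * l * a)
    (by simp only [hW]; fun_prop)
    (by simp only [hW, hw0]; field_simp; ring)
    (by
      have e : (fun z => hW l a b c ((0:ℂ), z).2 ((0:ℂ), z).1) = fun z => a * (l - 1) + (-2 * l * a) * z := by
        funext z; simp only [hW]; ring
      rw [e]
      have := ((hasDerivAt_id' w0).const_mul (-2 * l * a)).const_add (a * (l - 1))
      simpa using this)
    (by simp [hl, ha])
  refine ⟨fun s => mk3 (s ^ 3 * ψ s) s 1, ⟨?_, ?_, ?_, ?_⟩, ?_, ?_⟩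
  · exact mk3_an (by fun_prop) (by fun_prop) (by fun_prop)
  · simp
  · simp [fP]
  · have hφ0 : (1 - ψ 0) * (1 + l * ψ 0) ≠ 0 := by
      have : (1 - ψ 0) * (1 + l * ψ 0) = (l + 1) ^ 2 / (4 * l) := by
        rw [hψ0, hw0]; field_simp; ring
      rw [this]
      exact div_ne_zero (pow_ne_zero _ hl1) (by simp [hl])
    have c1 : ∀ᶠ s in 𝓝 (0:ℂ), (1 - ψ s) * (1 + l * ψ s) ≠ 0 := by
      refine ContinuousAt.eventually_ne ?_ hφ0
      have := hψa.continuousAt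
      fun_prop
    filter_upwards [c1.filter_mono nhdsWithin_le_nhds,
      hψ1.filter_mono nhdsWithin_le_nhds, self_mem_nhdsWithin] with s h1 h3 h4
    simp only [mk3_0, mk3_1, mk3_2]
    rw [fP_hW, gP_hW, h3]
    exact ⟨mul_ne_zero (pow_ne_zero _ h4) h1, mul_zero _⟩
  · simp
  · intro r hr
    let A : ℂ × ℂ → ℂ := fun v => (v.1 + v.2 + 1) * (3 * b * v.2 ^ 2 * (l - 1) +
      (a + 2 * c * v.1) * (-2 * l)) + 7 * (a + b + c) * l * v.1
    let B : ℂ × ℂ → ℂ := fun v => (v.1 + v.2 + 1) * (6 * b * v.2 ^ 2 +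
      (a + 2 * c * v.1) * (l - 1)) - 7 * (a + b + c) * (v.2 ^ 3 + (l - 1) * v.1)
    have hAB : ∀ v : ℂ × ℂ, gP l a b c v.1 v.2 1 = v.1 * A v + v.2 ^ 3 * B v := by
      intro v; simp only [gP, dP, fP, A, B]; ring
    have hAc : Continuous A := by fun_prop
    have hBc : Continuous B := by fun_prop
    have hA0 : A (0, 0) ≠ 0 := by simp [A, ha, hl]
    have hc : ContinuousAt (fun v : ℂ × ℂ => (v.2, - B v / A v)) (0, 0) :=
      continuous_snd.continuousAt.prodMk (hBc.neg.continuousAt.div hAc.continuousAt hA0)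
    have e0 : (fun v : ℂ × ℂ => (v.2, - B v / A v)) (0, 0) = (0, w0) := by
      simp only [Prod.mk.injEq, true_and, hw0]
      rw [div_eq_div_iff hA0 (by simp [hl])]
      simp only [A, B]; ring
    replace hc := tend_of_cont hc e0
    have hne : ∀ᶠ v : ℂ × ℂ in 𝓝 (0, 0), A v ≠ 0 := hAc.continuousAt.eventually_ne hA0
    have hball : ∀ᶠ v : ℂ × ℂ in 𝓝 ((0:ℂ), w0), ‖v.1‖ < r := by
      apply (Continuous.continuousAt (by fun_prop : Continuous fun v : ℂ × ℂ => ‖v.1‖)).eventually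
        (gt_mem_nhds _)
      simpa using hr
    filter_upwards [hc.eventually hψ2, hc.eventually hball, hne] with v h1 h2 h3 hg hf
    have hX : v.1 = v.2 ^ 3 * (- B v / A v) := by
      rw [hAB] at hg
      field_simp
      linear_combination hg
    have hY : v.2 ≠ 0 := by
      intro h
      apply hf
      rw [hX, fP_hW, h]; simp
    refine ⟨v.2, hY, h2, ?_⟩
    have hg' := hg
    rw [hX, gP_hW] at hg'
    have := h1 ((mul_eq_zero.1 hg').resolve_left (pow_ne_zero _ hY))
    rw [← this, ← hX]


lemma pair_of_nhds {P : ℂ × ℂ → Prop} {z0 : ℂ} (h : ∀ᶠ v in 𝓝 ((0:ℂ), z0), P v) :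
    ∃ δ > 0, ∀ s z : ℂ, ‖s‖ < δ → ‖z - z0‖ < δ → P (s, z) := by
  obtain ⟨δ, hδ, H⟩ := Metric.eventually_nhds_iff.1 h
  refine ⟨δ, hδ, fun s z hs hz => H ?_⟩
  rw [Prod.dist_eq]
  simp only [dist_zero_right]
  exact max_lt hs (by rwa [dist_eq_norm])

lemma branchC1 (a b c : ℂ) (hb : b ≠ 0) (hc0 : c ≠ 0) :
    ∃ q : ℂ → C3, Br 1 a b c q ∧ q 0 = mk3 1 0 0 ∧
      ∀ r > 0, ∀ᶠ v : ℂ × ℂ in 𝓝 (0, 0), gP 1 a b c 1 v.1 v.2 = 0 → fP 1 1 v.1 v.2 ≠ 0 →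
        ∃ s : ℂ, s ≠ 0 ∧ ‖s‖ < r ∧ mk3 1 v.1 v.2 = q s := by
  obtain ⟨z0, hz0⟩ : ∃ z0 : ℂ, z0 ^ 3 = 3 * b / (2 * c) :=
    IsAlgClosed.exists_pow_nat_eq _ (by norm_num)
  have hz0n : z0 ≠ 0 := by
    rintro rfl
    have : 3 * b / (2 * c) ≠ 0 := by simp [hb, hc0]
    apply this; rw [← hz0]; simp
  let H : ℂ × ℂ → ℂ := fun v => (1 + v.1 ^ 3 + v.1 ^ 5 * v.2) *
    (6 * b - 2 * a * v.1 ^ 5 * v.2 ^ 4 - 4 * c * v.2 ^ 3) - 7 * (a + b + c) * (v.1 ^ 3 - v.1 ^ 5 * v.2 ^ 4)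
  have hgH : ∀ s z : ℂ, gP 1 a b c 1 (s ^ 3) (s ^ 5 * z) = s ^ 15 * H (s, z) := by
    intro s z; simp only [gP, dP, fP, H]; ring
  have hfH : ∀ s z : ℂ, fP 1 1 (s ^ 3) (s ^ 5 * z) = s ^ 18 * (1 - s ^ 2 * z ^ 4) := by
    intro s z; simp only [fP]; ring
  obtain ⟨ψ, hψa, hψ0, hψ1, hψ2⟩ := ift2 H z0 (-12 * c * z0 ^ 2)
    (by simp only [H]; fun_prop)
    (by simp only [H, hz0]; field_simp; ring)
    (by
      have e : (fun z => H (0, z)) = fun z => 6 * b - 4 * c * z ^ 3 := by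
        funext z; simp only [H]; ring
      rw [e]
      have := ((hasDerivAt_pow 3 z0).const_mul (4 * c)).const_sub (6 * b)
      convert! this using 1
      push_cast; ring)
    (by simp [hc0, hz0n])
  refine ⟨fun s => mk3 1 (s ^ 3) (s ^ 5 * ψ s), ⟨?_, ?_, ?_, ?_⟩, ?_, ?_⟩
  · exact mk3_an (by fun_prop) (by fun_prop) (by fun_prop)
  · simp
  · simp [fP]
  · have c1 : ∀ᶠ s in 𝓝 (0:ℂ), 1 - s ^ 2 * ψ s ^ 4 ≠ 0 := by
      refine ContinuousAt.eventually_ne ?_ (by simp)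
      have := hψa.continuousAt
      fun_prop
    filter_upwards [c1.filter_mono nhdsWithin_le_nhds,
      hψ1.filter_mono nhdsWithin_le_nhds, self_mem_nhdsWithin] with s h1 h3 h4
    simp only [mk3_0, mk3_1, mk3_2]
    rw [hfH, hgH, h3]
    exact ⟨mul_ne_zero (pow_ne_zero _ h4) h1, mul_zero _⟩
  · simp
  · intro r hr
    let A : ℂ × ℂ → ℂ := fun v => 6 * b * (1 + v.1 + v.2) - 7 * (a + b + c) * v.1
    let B : ℂ × ℂ → ℂ := fun v => (1 + v.1 + v.2) * (2 * a * v.2 + 4 * c) - 7 * (a + b + c) * v.2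
    have hAB : ∀ v : ℂ × ℂ, gP 1 a b c 1 v.1 v.2 = v.1 ^ 5 * A v - v.2 ^ 3 * B v := by
      intro v; simp only [gP, dP, fP, A, B]; ring
    have hAc : Continuous A := by fun_prop
    have hBc : Continuous B := by fun_prop
    have hA0 : A (0, 0) ≠ 0 := by simp [A, hb]
    have hB0 : B (0, 0) ≠ 0 := by simp [B, hc0]
    let Z : ℂ × ℂ → ℂ := fun v => z0 * (A v / B v / z0 ^ 3) ^ ((3:ℕ) : ℂ)⁻¹
    have hZ3 : ∀ v, Z v ^ 3 = A v / B v := by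
      intro v
      simp only [Z, mul_pow]
      rw [Complex.cpow_nat_inv_pow _ (by norm_num)]
      field_simp
    have hone : A (0, 0) / B (0, 0) / z0 ^ 3 = 1 := by
      rw [hz0, div_div, div_eq_one_iff_eq (mul_ne_zero hB0 (by simp [hb, hc0]))]
      simp only [A, B]; field_simp; ring
    have hZc : ContinuousAt Z (0, 0) := by
      refine continuousAt_const.mul (ContinuousAt.cpow ?_ continuousAt_const ?_)
      · exact (hAc.continuousAt.div hBc.continuousAt hB0).div_const _
      · rw [hone]; simp
    have hZ0 : Z (0, 0) = z0 := by simp only [Z, hone]; simp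
    have hZt := tend_of_cont hZc hZ0
    obtain ⟨δ, hδ, hδ2⟩ := pair_of_nhds hψ2
    set η := min δ r with hη
    have hη0 : 0 < η := lt_min hδ hr
    have e1 : ∀ᶠ v : ℂ × ℂ in 𝓝 (0, 0), ‖v.1‖ < η ^ 3 := by
      apply (Continuous.continuousAt (by fun_prop : Continuous fun v : ℂ × ℂ => ‖v.1‖)).eventually
        (gt_mem_nhds _)
      simp only [norm_zero]; positivity
    have e2 : ∀ᶠ v : ℂ × ℂ in 𝓝 (0, 0), ‖Z v - z0‖ < δ := by
      have := hZt.eventually (Metric.ball_mem_nhds z0 hδ)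
      filter_upwards [this] with v hv
      rwa [← dist_eq_norm]
    filter_upwards [e1, e2, hAc.continuousAt.eventually_ne hA0, hBc.continuousAt.eventually_ne hB0]
      with v h1 h2 h3 h4 hg hf
    have hg' := hg
    rw [hAB] at hg'
    have hv2 : v.2 ≠ 0 := by
      intro h
      have : v.1 = 0 := by
        rw [h] at hg'
        have : v.1 ^ 5 * A v = 0 := by linear_combination hg'
        exact pow_eq_zero_iff (by norm_num) |>.1 ((mul_eq_zero.1 this).resolve_right h3)
      apply hf; rw [h, this]; simp [fP]
    have hv1 : v.1 ≠ 0 := by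
      intro h
      rw [h] at hg'
      have : v.2 ^ 3 * B v = 0 := by linear_combination -hg'
      exact (mul_ne_zero (pow_ne_zero _ hv2) h4) this
    have hη' : Z v ^ 3 * v.1 ^ 5 = v.2 ^ 3 := by
      rw [hZ3]; field_simp; linear_combination hg'
    have hs3 : (Z v * v.1 ^ 2 / v.2) ^ 3 = v.1 := by
      field_simp
      linear_combination hη'
    have hs5 : (Z v * v.1 ^ 2 / v.2) ^ 5 * Z v = v.2 := by
      field_simp
      linear_combination (Z v ^ 3 * v.1 ^ 5 + v.2 ^ 3) * hη'
    have hsn : ‖Z v * v.1 ^ 2 / v.2‖ < η := by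
      refine lt_of_pow_lt_pow_left₀ 3 hη0.le ?_
      rw [← norm_pow, hs3]; exact h1
    have hs0 : Z v * v.1 ^ 2 / v.2 ≠ 0 := by
      intro h; rw [h] at hs3; apply hv1; rw [← hs3]; simp
    refine ⟨_, hs0, hsn.trans_le (min_le_right _ _), ?_⟩
    have := hδ2 _ (Z v) (hsn.trans_le (min_le_left _ _)) h2 ?_
    · simp only at this
      rw [← this, hs3, hs5]
    · have hh := hgH (Z v * v.1 ^ 2 / v.2) (Z v)
      rw [hs3, hs5, hg] at hh
      exact (mul_eq_zero.1 hh.symm).resolve_left (pow_ne_zero _ hs0)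

lemma branchD1 (a b c : ℂ) (hc0 : c ≠ 0) :
    ∃ q : ℂ → C3, Br 2 a b c q ∧ q 0 = mk3 1 0 0 ∧
      (∀ᶠ s in 𝓝[≠] (0:ℂ), 8 * ‖q s 2 ^ 2 * q s 0‖ < ‖q s 1 ^ 3‖) ∧
      ∀ r > 0, ∀ᶠ v : ℂ × ℂ in 𝓝 (0, 0), gP 2 a b c 1 v.1 v.2 = 0 → fP 2 1 v.1 v.2 ≠ 0 →
        8 * ‖v.2 ^ 2‖ ≤ ‖v.1 ^ 3‖ →
        ∃ s : ℂ, s ≠ 0 ∧ ‖s‖ < r ∧ mk3 1 v.1 v.2 = q s := by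
  set z0 : ℂ := - 3 * b / c with hz0
  let H : ℂ × ℂ → ℂ := fun v => (1 + v.1 + v.1 ^ 2 * v.2) *
    (3 * b * (2 + v.1 * v.2 ^ 2) + (a * v.1 ^ 2 * v.2 ^ 2 + 2 * c * v.2) * (1 - 4 * v.1 * v.2 ^ 2)) -
      7 * (a + b + c) * v.1 * (1 - v.1 * v.2 ^ 2) * (1 + 2 * v.1 * v.2 ^ 2)
  have hgH : ∀ s z : ℂ, gP 2 a b c 1 s (s ^ 2 * z) = s ^ 5 * H (s, z) := by
    intro s z; simp only [gP, dP, fP, H]; ring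
  have hfH : ∀ s z : ℂ, fP 2 1 s (s ^ 2 * z) = s ^ 6 * ((1 - s * z ^ 2) * (1 + 2 * s * z ^ 2)) := by
    intro s z; simp only [fP]; ring
  obtain ⟨ψ, hψa, hψ0, hψ1, hψ2⟩ := ift2 H z0 (2 * c)
    (by simp only [H]; fun_prop)
    (by simp only [H, hz0]; field_simp; ring)
    (by
      have e : (fun z => H (0, z)) = fun z => 6 * b + 2 * c * z := by
        funext z; simp only [H]; ring
      rw [e]
      have := ((hasDerivAt_id' z0).const_mul (2 * c)).const_add (6 * b)
      simpa using this)
    (by simp [hc0])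
  have hψc := hψa.continuousAt
  refine ⟨fun s => mk3 1 s (s ^ 2 * ψ s), ⟨?_, ?_, ?_, ?_⟩, ?_, ?_, ?_⟩
  · exact mk3_an (by fun_prop) (by fun_prop) (by fun_prop)
  · simp
  · simp [fP]
  · have c1 : ∀ᶠ s in 𝓝 (0:ℂ), (1 - s * ψ s ^ 2) * (1 + 2 * s * ψ s ^ 2) ≠ 0 := by
      refine ContinuousAt.eventually_ne ?_ (by simp)
      fun_prop
    filter_upwards [c1.filter_mono nhdsWithin_le_nhds,
      hψ1.filter_mono nhdsWithin_le_nhds, self_mem_nhdsWithin] with s h1 h3 h4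
    simp only [mk3_0, mk3_1, mk3_2]
    rw [hfH, hgH, h3]
    exact ⟨mul_ne_zero (pow_ne_zero _ h4) h1, mul_zero _⟩
  · simp
  · have c1 : ∀ᶠ s in 𝓝 (0:ℂ), 8 * ‖s * ψ s ^ 2‖ < 1 := by
      have : ContinuousAt (fun s => 8 * ‖s * ψ s ^ 2‖) 0 := by fun_prop
      apply this.eventually (gt_mem_nhds _)
      simp
    filter_upwards [c1.filter_mono nhdsWithin_le_nhds, self_mem_nhdsWithin] with s h1 h4
    have h4' : 0 < ‖s‖ := norm_pos_iff.2 h4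
    simp only [mk3_0, mk3_1, mk3_2]
    have e : (s ^ 2 * ψ s) ^ 2 * 1 = s ^ 3 * (s * ψ s ^ 2) := by ring
    rw [e, norm_mul, norm_pow]
    nlinarith [pow_pos h4' 3]
  · intro r hr
    suffices hs : ∀ᶠ v : ℂ × ℂ in 𝓝 (0, 0) ⊓ 𝓟 {v | gP 2 a b c 1 v.1 v.2 = 0 ∧ fP 2 1 v.1 v.2 ≠ 0 ∧
        8 * ‖v.2 ^ 2‖ ≤ ‖v.1 ^ 3‖}, ∃ s : ℂ, s ≠ 0 ∧ ‖s‖ < r ∧ mk3 1 v.1 v.2 = mk3 1 s (s ^ 2 * ψ s) by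
      rw [eventually_inf_principal] at hs
      filter_upwards [hs] with v hv h1 h2 h3
      exact hv ⟨h1, h2, h3⟩
    set F := 𝓝 ((0:ℂ), (0:ℂ)) ⊓ 𝓟 {v : ℂ × ℂ | gP 2 a b c 1 v.1 v.2 = 0 ∧ fP 2 1 v.1 v.2 ≠ 0 ∧
        8 * ‖v.2 ^ 2‖ ≤ ‖v.1 ^ 3‖} with hF
    have hFn : F ≤ 𝓝 (0, 0) := inf_le_left
    have hFm : ∀ᶠ v in F, gP 2 a b c 1 v.1 v.2 = 0 ∧ fP 2 1 v.1 v.2 ≠ 0 ∧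
        8 * ‖v.2 ^ 2‖ ≤ ‖v.1 ^ 3‖ := mem_inf_of_right (mem_principal_self _)
    have tY : Tendsto (fun v : ℂ × ℂ => v.1) F (𝓝 0) := (continuous_fst.tendsto ((0:ℂ), (0:ℂ))).mono_left hFn
    have tZ : Tendsto (fun v : ℂ × ℂ => v.2) F (𝓝 0) := (continuous_snd.tendsto ((0:ℂ), (0:ℂ))).mono_left hFn
    let L : ℂ × ℂ → ℂ := fun v => 1 + v.1 + v.2
    let A : ℂ × ℂ → ℂ := fun v => (2 * c + a * v.2) * L v
    let W : ℂ × ℂ → ℂ := fun v => v.2 ^ 2 / v.1 ^ 3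
    let N : ℂ × ℂ → ℂ := fun v => 3 * b * (2 + W v) * L v -
      7 * (a + b + c) * v.1 * ((1 - W v) * (1 + 2 * W v))
    have tL : Tendsto L F (𝓝 1) := by
      have : Tendsto L F (𝓝 (1 + 0 + 0)) := (tendsto_const_nhds.add tY).add tZ
      simpa using this
    have tA : Tendsto A F (𝓝 (2 * c)) := by
      have : Tendsto A F (𝓝 ((2 * c + a * 0) * 1)) :=
        (tendsto_const_nhds.add (tendsto_const_nhds.mul tZ)).mul tL
      simpa using this
    have hY : ∀ᶠ v in F, v.1 ≠ 0 := by
      filter_upwards [hFm] with v hv h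
      have h3 := hv.2.2
      rw [h] at h3
      have : v.2 = 0 := by
        simp at h3
        by_contra hne
        have := pow_pos (norm_pos_iff.2 hne) 2
        linarith
      apply hv.2.1
      rw [h, this]; simp [fP]
    have hW : ∀ᶠ v in F, ‖W v‖ ≤ 1 / 8 := by
      filter_upwards [hFm, hY] with v hv h
      simp only [W, norm_div]
      rw [div_le_iff₀ (norm_pos_iff.2 (pow_ne_zero 3 h))]
      linarith [hv.2.2]
    have hcp : 0 < ‖c‖ := norm_pos_iff.2 hc0
    have hA : ∀ᶠ v in F, ‖c‖ ≤ ‖A v‖ := by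
      have := tA.norm
      have h2 : ‖c‖ < ‖2 * c‖ := by rw [norm_mul]; simp; linarith
      filter_upwards [this.eventually (lt_mem_nhds h2)] with v hv using hv.le
    have hLb : ∀ᶠ v in F, ‖L v‖ ≤ 2 := by
      have := tL.norm
      have h2 : ‖(1:ℂ)‖ < 2 := by simp
      filter_upwards [this.eventually (gt_mem_nhds h2)] with v hv using hv.le
    have hYb : ∀ᶠ v in F, ‖v.1‖ ≤ 1 := by
      have := tY.norm
      have h2 : ‖(0:ℂ)‖ < 1 := by simp
      filter_upwards [this.eventually (gt_mem_nhds h2)] with v hv using hv.le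
    have hW4 : ∀ᶠ v in F, 1 / 2 ≤ ‖1 - 4 * W v‖ := by
      filter_upwards [hW] with v hv
      have := norm_sub_norm_le (1:ℂ) (4 * W v)
      simp only [norm_one, norm_mul, Complex.norm_ofNat] at this
      linarith
    have hZe : ∀ᶠ v in F, v.2 / v.1 ^ 2 = - N v / (A v * (1 - 4 * W v)) := by
      filter_upwards [hFm, hY, hA, hW4] with v hv h1 h2 h3
      have hAn : A v ≠ 0 := by
        intro h; rw [h, norm_zero] at h2; linarith
      have hWn : 1 - 4 * W v ≠ 0 := by
        intro h; rw [h, norm_zero] at h3; linarith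
      rw [eq_div_iff (mul_ne_zero hAn hWn)]
      have hg := hv.1
      have key : gP 2 a b c 1 v.1 v.2 = v.1 ^ 5 * (v.2 / v.1 ^ 2 * (A v * (1 - 4 * W v)) + N v) := by
        simp only [gP, dP, fP, A, N, W, L]; field_simp; ring
      rw [key] at hg
      have := (mul_eq_zero.1 hg).resolve_left (pow_ne_zero _ h1)
      linear_combination this
    let M : ℝ := 3 * ‖b‖ * 3 * 2 + 7 * ‖a + b + c‖ * 1 * (2 * 2)
    have hNb : ∀ᶠ v in F, ‖N v‖ ≤ M := by
      filter_upwards [hW, hLb, hYb] with v h1 h2 h3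
      have n1 : ‖2 + W v‖ ≤ 3 := by
        have := norm_add_le (2:ℂ) (W v)
        simp only [Complex.norm_ofNat] at this; linarith
      have n2 : ‖1 - W v‖ ≤ 2 := by
        have := norm_sub_le (1:ℂ) (W v)
        simp only [norm_one] at this; linarith
      have n3 : ‖1 + 2 * W v‖ ≤ 2 := by
        have := norm_add_le (1:ℂ) (2 * W v)
        simp only [norm_one, norm_mul, Complex.norm_ofNat] at this; linarith
      refine (norm_sub_le _ _).trans ?_
      simp only [norm_mul, Complex.norm_ofNat, M]
      gcongr
    have hM0 : 0 ≤ M := by positivity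
    let K : ℝ := M / (‖c‖ * (1 / 2))
    have hZb : ∀ᶠ v in F, ‖v.2 / v.1 ^ 2‖ ≤ K := by
      filter_upwards [hZe, hNb, hA, hW4] with v h1 h2 h3 h4
      rw [h1, norm_div, norm_neg, norm_mul]
      simp only [K]
      gcongr
    have tW : Tendsto W F (𝓝 0) := by
      rw [tendsto_zero_iff_norm_tendsto_zero]
      have t1 : Tendsto (fun v : ℂ × ℂ => ‖v.1‖ * K ^ 2) F (𝓝 0) := by
        have := tY.norm.mul_const (K ^ 2)
        simpa using this
      refine squeeze_zero' (Eventually.of_forall fun _ => norm_nonneg _) ?_ t1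
      filter_upwards [hZb, hY] with v h1 h2
      have : W v = v.1 * (v.2 / v.1 ^ 2) ^ 2 := by simp only [W]; field_simp
      rw [this, norm_mul, norm_pow]
      gcongr
    have tN : Tendsto N F (𝓝 (6 * b)) := by
      have : Tendsto N F (𝓝 (3 * b * (2 + 0) * 1 - 7 * (a + b + c) * 0 * ((1 - 0) * (1 + 2 * 0)))) :=
        ((tendsto_const_nhds.mul (tendsto_const_nhds.add tW)).mul tL).sub
          ((tendsto_const_nhds.mul tY).mul ((tendsto_const_nhds.sub tW).mul
            (tendsto_const_nhds.add (tendsto_const_nhds.mul tW))))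
      convert! this using 2
      ring
    have tz : Tendsto (fun v : ℂ × ℂ => v.2 / v.1 ^ 2) F (𝓝 z0) := by
      have : Tendsto (fun v => - N v / (A v * (1 - 4 * W v))) F (𝓝 (- (6 * b) / (2 * c * (1 - 4 * 0)))) :=
        tN.neg.div (tA.mul (tendsto_const_nhds.sub (tendsto_const_nhds.mul tW))) (by simp [hc0])
      have e : - (6 * b) / (2 * c * (1 - 4 * 0)) = z0 := by
        rw [hz0]; field_simp; ring
      rw [e] at this
      exact this.congr' (hZe.mono fun v h => h.symm)
    have tp : Tendsto (fun v : ℂ × ℂ => (v.1, v.2 / v.1 ^ 2)) F (𝓝 (0, z0)) := by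
      rw [nhds_prod_eq]; exact tY.prodMk tz
    have hYr : ∀ᶠ v in F, ‖v.1‖ < r := by
      have := tY.norm
      exact this.eventually (gt_mem_nhds (by simpa using hr))
    filter_upwards [tp.eventually hψ2, hYr, hY, hFm] with v h1 h2 h3 h4
    have e : v.2 = v.1 ^ 2 * (v.2 / v.1 ^ 2) := by field_simp
    refine ⟨v.1, h3, h2, ?_⟩
    have hg := h4.1
    rw [e, hgH] at hg
    rw [← h1 ((mul_eq_zero.1 hg).resolve_left (pow_ne_zero _ h3)), ← e]

lemma branchD2 (a b c : ℂ) (hc0 : c ≠ 0) :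
    ∃ q : ℂ → C3, Br 2 a b c q ∧ q 0 = mk3 1 0 0 ∧
      (∀ᶠ s in 𝓝[≠] (0:ℂ), ‖q s 1 ^ 3‖ < 8 * ‖q s 2 ^ 2 * q s 0‖) ∧
      ∀ r > 0, ∀ᶠ v : ℂ × ℂ in 𝓝 (0, 0), gP 2 a b c 1 v.1 v.2 = 0 → fP 2 1 v.1 v.2 ≠ 0 →
        ‖v.1 ^ 3‖ ≤ 8 * ‖v.2 ^ 2‖ →
        ∃ s : ℂ, s ≠ 0 ∧ ‖s‖ < r ∧ mk3 1 v.1 v.2 = q s := by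
  set z0 : ℂ := 1 / 2 with hz0
  let H : ℂ × ℂ → ℂ := fun v => (1 + v.1 ^ 2 + v.1 ^ 3 * v.2) *
    (3 * b * v.1 * (2 + v.2 ^ 2) + (a * v.1 ^ 3 * v.2 ^ 2 + 2 * c * v.2) * (1 - 4 * v.2 ^ 2)) -
      7 * (a + b + c) * v.1 ^ 3 * (1 - v.2 ^ 2) * (1 + 2 * v.2 ^ 2)
  have hgH : ∀ s z : ℂ, gP 2 a b c 1 (s ^ 2) (s ^ 3 * z) = s ^ 9 * H (s, z) := by
    intro s z; simp only [gP, dP, fP, H]; ring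
  have hfH : ∀ s z : ℂ, fP 2 1 (s ^ 2) (s ^ 3 * z) = s ^ 12 * ((1 - z ^ 2) * (1 + 2 * z ^ 2)) := by
    intro s z; simp only [fP]; ring
  obtain ⟨ψ, hψa, hψ0, hψ1, hψ2⟩ := ift2 H z0 (-4 * c)
    (by simp only [H]; fun_prop)
    (by simp only [H, hz0]; ring)
    (by
      have e : (fun z => H (0, z)) = fun z => 2 * c * z - 8 * c * z ^ 3 := by
        funext z; simp only [H]; ring
      rw [e]
      have := ((hasDerivAt_id' z0).const_mul (2 * c)).sub ((hasDerivAt_pow 3 z0).const_mul (8 * c))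
      convert! this using 1
      rw [hz0]; push_cast; ring)
    (by simp [hc0])
  have hψc := hψa.continuousAt
  refine ⟨fun s => mk3 1 (s ^ 2) (s ^ 3 * ψ s), ⟨?_, ?_, ?_, ?_⟩, ?_, ?_, ?_⟩
  · exact mk3_an (by fun_prop) (by fun_prop) (by fun_prop)
  · simp
  · simp [fP]
  · have c1 : ∀ᶠ s in 𝓝 (0:ℂ), (1 - ψ s ^ 2) * (1 + 2 * ψ s ^ 2) ≠ 0 := by
      refine ContinuousAt.eventually_ne ?_ (by rw [hψ0, hz0]; norm_num)
      fun_prop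
    filter_upwards [c1.filter_mono nhdsWithin_le_nhds,
      hψ1.filter_mono nhdsWithin_le_nhds, self_mem_nhdsWithin] with s h1 h3 h4
    simp only [mk3_0, mk3_1, mk3_2]
    rw [hfH, hgH, h3]
    exact ⟨mul_ne_zero (pow_ne_zero _ h4) h1, mul_zero _⟩
  · simp
  · have c1 : ∀ᶠ s in 𝓝 (0:ℂ), 1 < 8 * ‖ψ s ^ 2‖ := by
      have : ContinuousAt (fun s => 8 * ‖ψ s ^ 2‖) 0 := by fun_prop
      apply this.eventually (lt_mem_nhds _)
      show 1 < 8 * ‖ψ 0 ^ 2‖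
      rw [hψ0, hz0]; norm_num
    filter_upwards [c1.filter_mono nhdsWithin_le_nhds, self_mem_nhdsWithin] with s h1 h4
    have h4' : 0 < ‖s‖ := norm_pos_iff.2 h4
    simp only [mk3_0, mk3_1, mk3_2]
    have e : (s ^ 3 * ψ s) ^ 2 * 1 = s ^ 6 * (ψ s ^ 2) := by ring
    have e' : (s ^ 2) ^ 3 = s ^ 6 := by ring
    rw [e, e', norm_mul, norm_pow]
    nlinarith [pow_pos h4' 6]
  · intro r hr
    suffices hs : ∀ᶠ v : ℂ × ℂ in 𝓝 (0, 0) ⊓ 𝓟 {v | gP 2 a b c 1 v.1 v.2 = 0 ∧ fP 2 1 v.1 v.2 ≠ 0 ∧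
        ‖v.1 ^ 3‖ ≤ 8 * ‖v.2 ^ 2‖}, ∃ s : ℂ, s ≠ 0 ∧ ‖s‖ < r ∧
          mk3 1 v.1 v.2 = mk3 1 (s ^ 2) (s ^ 3 * ψ s) by
      rw [eventually_inf_principal] at hs
      filter_upwards [hs] with v hv h1 h2 h3
      exact hv ⟨h1, h2, h3⟩
    set F := 𝓝 ((0:ℂ), (0:ℂ)) ⊓ 𝓟 {v : ℂ × ℂ | gP 2 a b c 1 v.1 v.2 = 0 ∧ fP 2 1 v.1 v.2 ≠ 0 ∧
        ‖v.1 ^ 3‖ ≤ 8 * ‖v.2 ^ 2‖} with hF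
    have hFn : F ≤ 𝓝 (0, 0) := inf_le_left
    have hFm : ∀ᶠ v in F, gP 2 a b c 1 v.1 v.2 = 0 ∧ fP 2 1 v.1 v.2 ≠ 0 ∧
        ‖v.1 ^ 3‖ ≤ 8 * ‖v.2 ^ 2‖ := mem_inf_of_right (mem_principal_self _)
    have tY : Tendsto (fun v : ℂ × ℂ => v.1) F (𝓝 0) := (continuous_fst.tendsto ((0:ℂ), (0:ℂ))).mono_left hFn
    have tZ : Tendsto (fun v : ℂ × ℂ => v.2) F (𝓝 0) := (continuous_snd.tendsto ((0:ℂ), (0:ℂ))).mono_left hFn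
    let L : ℂ × ℂ → ℂ := fun v => 1 + v.1 + v.2
    let A : ℂ × ℂ → ℂ := fun v => (2 * c + a * v.2) * L v
    let V : ℂ × ℂ → ℂ := fun v => v.1 ^ 3 / v.2 ^ 2
    let E : ℂ × ℂ → ℂ := fun v => v.1 ^ 2 / v.2
    have tL : Tendsto L F (𝓝 1) := by
      have : Tendsto L F (𝓝 (1 + 0 + 0)) := (tendsto_const_nhds.add tY).add tZ
      simpa using this
    have tA : Tendsto A F (𝓝 (2 * c)) := by
      have : Tendsto A F (𝓝 ((2 * c + a * 0) * 1)) :=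
        (tendsto_const_nhds.add (tendsto_const_nhds.mul tZ)).mul tL
      simpa using this
    have hZ : ∀ᶠ v in F, v.2 ≠ 0 := by
      filter_upwards [hFm] with v hv h
      have h3 := hv.2.2
      rw [h] at h3
      have : v.1 = 0 := by
        simp at h3
        by_contra hne
        have := pow_pos (norm_pos_iff.2 hne) 3
        linarith
      apply hv.2.1
      rw [h, this]; simp [fP]
    have hV : ∀ᶠ v in F, ‖V v‖ ≤ 8 := by
      filter_upwards [hFm, hZ] with v hv h
      simp only [V, norm_div]
      rw [div_le_iff₀ (norm_pos_iff.2 (pow_ne_zero 2 h))]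
      linarith [hv.2.2]
    have hcp : 0 < ‖c‖ := norm_pos_iff.2 hc0
    have hA : ∀ᶠ v in F, ‖c‖ ≤ ‖A v‖ := by
      have := tA.norm
      have h2 : ‖c‖ < ‖2 * c‖ := by rw [norm_mul]; simp; linarith
      filter_upwards [this.eventually (lt_mem_nhds h2)] with v hv using hv.le
    have hLb : ∀ᶠ v in F, ‖L v‖ ≤ 2 := by
      have := tL.norm
      have h2 : ‖(1:ℂ)‖ < 2 := by simp
      filter_upwards [this.eventually (gt_mem_nhds h2)] with v hv using hv.le
    have tE : Tendsto E F (𝓝 0) := by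
      have t2 : Tendsto (fun v => ‖E v‖ ^ 2) F (𝓝 0) := by
        have t1 : Tendsto (fun v : ℂ × ℂ => ‖v.1‖ * 8) F (𝓝 0) := by
          have := tY.norm.mul_const 8
          simpa using this
        refine squeeze_zero' (Eventually.of_forall fun _ => by positivity) ?_ t1
        filter_upwards [hV, hZ] with v h1 h2
        have : E v ^ 2 = v.1 * V v := by simp only [E, V]; field_simp
        rw [← norm_pow, this, norm_mul]
        gcongr
      rw [tendsto_zero_iff_norm_tendsto_zero]
      have := t2.sqrt
      simpa [Real.sqrt_sq] using this
    have hVe : ∀ᶠ v in F, V v - 4 = - (3 * b * E v * (2 * V v + 1) * L v -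
        7 * (a + b + c) * v.2 * ((V v - 1) * (V v + 2))) / A v := by
      filter_upwards [hFm, hZ, hA] with v hv h1 h2
      have hAn : A v ≠ 0 := by
        intro h; rw [h, norm_zero] at h2; linarith
      rw [eq_div_iff hAn]
      have hg := hv.1
      have key : gP 2 a b c 1 v.1 v.2 = v.2 ^ 3 * ((V v - 4) * A v + (3 * b * E v * (2 * V v + 1) * L v -
        7 * (a + b + c) * v.2 * ((V v - 1) * (V v + 2)))) := by
        simp only [gP, dP, fP, A, E, V, L]; field_simp; ring
      rw [key] at hg
      have := (mul_eq_zero.1 hg).resolve_left (pow_ne_zero _ h1)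
      linear_combination this
    have tV : Tendsto V F (𝓝 4) := by
      rw [← tendsto_sub_nhds_zero_iff, tendsto_zero_iff_norm_tendsto_zero]
      have t1 : Tendsto (fun v : ℂ × ℂ => (3 * ‖b‖ * ‖E v‖ * 17 * 2 +
          7 * ‖a + b + c‖ * ‖v.2‖ * (9 * 10)) / ‖c‖) F
          (𝓝 ((3 * ‖b‖ * ‖(0:ℂ)‖ * 17 * 2 + 7 * ‖a + b + c‖ * ‖(0:ℂ)‖ * (9 * 10)) / ‖c‖)) :=
        ((((tE.norm.const_mul _).mul_const _).mul_const _).add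
          ((tZ.norm.const_mul _).mul_const _)).div_const _
      simp only [norm_zero, mul_zero, zero_mul, add_zero, zero_div] at t1
      refine squeeze_zero' (Eventually.of_forall fun _ => norm_nonneg _) ?_ t1
      filter_upwards [hVe, hV, hLb, hA] with v h1 h2 h3 h4
      have n1 : ‖2 * V v + 1‖ ≤ 17 := by
        have := norm_add_le (2 * V v) (1:ℂ)
        simp only [norm_one, norm_mul, Complex.norm_ofNat] at this; linarith
      have n2 : ‖V v - 1‖ ≤ 9 := by
        have := norm_sub_le (V v) (1:ℂ)
        simp only [norm_one] at this; linarith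
      have n3 : ‖V v + 2‖ ≤ 10 := by
        have := norm_add_le (V v) (2:ℂ)
        simp only [Complex.norm_ofNat] at this; linarith
      rw [h1, norm_div, norm_neg]
      have n4 : ‖3 * b * E v * (2 * V v + 1) * L v -
        7 * (a + b + c) * v.2 * ((V v - 1) * (V v + 2))‖ ≤ 3 * ‖b‖ * ‖E v‖ * 17 * 2 +
          7 * ‖a + b + c‖ * ‖v.2‖ * (9 * 10) := by
        refine (norm_sub_le _ _).trans ?_
        simp only [norm_mul, Complex.norm_ofNat]
        gcongr
      gcongr
    let Z : ℂ × ℂ → ℂ := fun v => (1 / 2) * (4 / V v) ^ ((2:ℕ) : ℂ)⁻¹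
    have hZ2 : ∀ v, Z v ^ 2 = 1 / V v := by
      intro v
      simp only [Z, mul_pow]
      rw [Complex.cpow_nat_inv_pow _ (by norm_num)]
      ring
    have tZZ : Tendsto Z F (𝓝 z0) := by
      have h1 : Tendsto (fun v => 4 / V v) F (𝓝 1) := by
        have : Tendsto (fun v => 4 / V v) F (𝓝 (4 / 4)) := tendsto_const_nhds.div tV (by norm_num)
        simpa using this
      have h2 : ContinuousAt (fun x : ℂ => (1 / 2) * x ^ ((2:ℕ) : ℂ)⁻¹) 1 := by
        refine continuousAt_const.mul (ContinuousAt.cpow continuousAt_id continuousAt_const ?_)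
        simp
      have h3 := tend_of_cont h2 (y := z0) (by simp [hz0])
      exact h3.comp h1
    obtain ⟨δ, hδ, hδ2⟩ := pair_of_nhds hψ2
    set η := min δ r with hη
    have hη0 : 0 < η := lt_min hδ hr
    have e1 : ∀ᶠ v in F, ‖v.1‖ < η ^ 2 := by
      exact tY.norm.eventually (gt_mem_nhds (by simp only [norm_zero]; positivity))
    have e2 : ∀ᶠ v in F, ‖Z v - z0‖ < δ := by
      have := tZZ.eventually (Metric.ball_mem_nhds z0 hδ)
      filter_upwards [this] with v hv
      rwa [← dist_eq_norm]
    have hV0 : ∀ᶠ v in F, V v ≠ 0 := tV.eventually_ne (by norm_num)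
    filter_upwards [e1, e2, hZ, hV0, hFm] with v h1 h2 h3 h4 h5
    have hv1 : v.1 ≠ 0 := by
      intro h; apply h4; simp [V, h]
    have hZn : Z v ≠ 0 := by
      intro h
      have := hZ2 v
      rw [h] at this
      simp at this
      exact h4 this.symm
    have hZ2' : Z v ^ 2 * v.1 ^ 3 = v.2 ^ 2 := by
      rw [hZ2]; simp only [V]; field_simp
    have hs2 : (v.2 / (v.1 * Z v)) ^ 2 = v.1 := by
      field_simp
      linear_combination -hZ2'
    have hs3 : (v.2 / (v.1 * Z v)) ^ 3 * Z v = v.2 := by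
      have : (v.2 / (v.1 * Z v)) ^ 3 * Z v = (v.2 / (v.1 * Z v)) ^ 2 * (v.2 / v.1) := by
        field_simp
      rw [this, hs2]; field_simp
    have hsn : ‖v.2 / (v.1 * Z v)‖ < η := by
      refine lt_of_pow_lt_pow_left₀ 2 hη0.le ?_
      rw [← norm_pow, hs2]; exact h1
    have hs0 : v.2 / (v.1 * Z v) ≠ 0 := div_ne_zero h3 (mul_ne_zero hv1 hZn)
    refine ⟨_, hs0, hsn.trans_le (min_le_right _ _), ?_⟩
    have := hδ2 _ (Z v) (hsn.trans_le (min_le_left _ _)) h2 ?_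
    · simp only at this
      rw [← this, hs2, hs3]
    · have hh := hgH (v.2 / (v.1 * Z v)) (Z v)
      rw [hs2, hs3, h5.1] at hh
      exact (mul_eq_zero.1 hh.symm).resolve_left (pow_ne_zero _ hs0)


lemma assemble {J K : Type*} [Fintype J] [Fintype K] (l a b c : ℂ) (X : J → ℂ × ℂ)
    (hX : Function.Injective X) (q : J → ℂ → C3) (hq : ∀ j, Br l a b c (q j))
    (hq0 : ∀ j, q j 0 = mk3 (X j).1 (X j).2 1) (hqc : ∀ j, CovZ l a b c (q j) (X j).1 (X j).2)
    (p : K → ℂ → C3) (hp : ∀ k, Br l a b c (p k)) (hp0 : ∀ k, p k 0 = mk3 1 0 0)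
    (W : K → Set C3) (hW : ∀ k, IsOpen (W k)) (hWd : Pairwise (fun i j => Disjoint (W i) (W j)))
    (hWc : ∀ i, ∀ p ∈ W i, ∀ t : ℂ, t ≠ 0 → t • p ∈ W i)
    (hpW : ∀ k, ∀ᶠ s in 𝓝[≠] (0:ℂ), p k s ∈ W k)
    (hpc : ∀ r > 0, ∀ᶠ v : ℂ × ℂ in 𝓝 (0, 0), gP l a b c 1 v.1 v.2 = 0 → fP l 1 v.1 v.2 ≠ 0 →
      ∃ i, ∃ s : ℂ, s ≠ 0 ∧ ‖s‖ < r ∧ mk3 1 v.1 v.2 = p i s)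
    (hcl : ∀ n : C3, n ≠ 0 → fP l (n 0) (n 1) (n 2) = 0 → dP l a b c (n 0) (n 1) (n 2) = 0 →
      (n 2 = 0 ∧ n 1 = 0) ∨ (n 2 ≠ 0 ∧ ∃ j, (n 0 / n 2, n 1 / n 2) = X j)) :
    ∃ ε₀ > (0:ℝ), ∀ ε, 0 < ε → ε ≤ ε₀ →
      Nat.card (ConnectedComponents ↥(Pol l a b c ∩ puncturedBall ε)) =
        Fintype.card J + Fintype.card K := by
  obtain ⟨V, hV, hVd⟩ := (Set.finite_range X).t2_separation
  obtain ⟨M, hM⟩ : ∃ M : ℝ, ∀ j, ‖(X j).1‖ < M := by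
    obtain ⟨M, hM⟩ := (Set.finite_range (fun j => ‖(X j).1‖)).bddAbove
    exact ⟨M + 1, fun j => (hM ⟨j, rfl⟩).trans_lt (lt_add_one _)⟩
  let U : J ⊕ K → Set C3 := Sum.elim
    (fun j => {p | p 2 ≠ 0 ∧ (p 0 / p 2, p 1 / p 2) ∈ V (X j) ∧ ‖p 0‖ < M * ‖p 2‖})
    (fun k => {p | M * ‖p 2‖ < ‖p 0‖} ∩ W k)
  rw [← Fintype.card_sum]
  have h0n : ∀ n : C3, n ≠ 0 → n 2 = 0 → n 1 = 0 → n 0 ≠ 0 := by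
    intro n hn h2 h1 h0
    apply hn; ext i; fin_cases i <;> simp [h0, h1, h2]
  refine main2 l a b c (Sum.elim q p) U ?_ ?_ ?_ ?_ ?_ ?_ ?_
  · rintro (j | k)
    · exact hq j
    · exact hp k
  · rintro (j | k)
    · have ho : IsOpen {p : C3 | p 2 ≠ 0} := isOpen_ne_fun (by fun_prop) (by fun_prop)
      have hc : ContinuousOn (fun p : C3 => (p 0 / p 2, p 1 / p 2)) {p : C3 | p 2 ≠ 0} := by
        refine ContinuousOn.prodMk ?_ ?_ <;> refine ContinuousOn.div ?_ ?_ (fun x hx => hx) <;>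
          exact Continuous.continuousOn (by fun_prop)
      have h1 := hc.isOpen_inter_preimage ho (hV (X j)).2
      have h2 : IsOpen {p : C3 | ‖p 0‖ < M * ‖p 2‖} := isOpen_lt (by fun_prop) (by fun_prop)
      convert h1.inter h2 using 1
      ext p; simp [U, and_assoc]
    · exact (isOpen_lt (by fun_prop) (by fun_prop)).inter (hW k)
  · rintro (j | k) (j' | k') hne
    · have : X j ≠ X j' := fun h => hne (by rw [hX h])
      have : Disjoint (V (X j)) (V (X j')) := hVd ⟨j, rfl⟩ ⟨j', rfl⟩ this
      rw [Set.disjoint_left] at this ⊢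
      intro p h1 h2
      exact this h1.2.1 h2.2.1
    · rw [Set.disjoint_left]
      intro p h1 h2
      exact absurd h1.2.2 (not_lt.2 h2.1.le)
    · rw [Set.disjoint_left]
      intro p h2 h1
      exact absurd h1.2.2 (not_lt.2 h2.1.le)
    · have : k ≠ k' := fun h => hne (by rw [h])
      exact (hWd this).mono inter_subset_right inter_subset_right
  · rintro (j | k) p hp t ht
    · obtain ⟨h1, h2, h3⟩ := hp
      have ht' := norm_pos_iff.2 ht
      refine ⟨by simp [ht, h1], ?_, ?_⟩
      · simpa [mul_div_mul_left _ _ ht] using h2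
      · simp only [PiLp.smul_apply, smul_eq_mul, norm_mul]
        nlinarith
    · obtain ⟨h1, h2⟩ := hp
      have ht' := norm_pos_iff.2 ht
      refine ⟨?_, hWc k p h2 t ht⟩
      simp only [mem_ofPred_eq, PiLp.smul_apply, smul_eq_mul, norm_mul] at h1 ⊢
      nlinarith
  · rintro (j | k)
    · have hc : ContinuousAt (q j) 0 := (hq j).an.continuousAt
      have h2 : ContinuousAt (fun s => q j s 2) 0 := by fun_prop
      have h0 : ContinuousAt (fun s => q j s 0) 0 := by fun_prop
      have h1 : ContinuousAt (fun s => q j s 1) 0 := by fun_prop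
      have e2 : q j 0 2 = 1 := by simp [hq0]
      have e0 : q j 0 0 = (X j).1 := by simp [hq0]
      have e1 : q j 0 1 = (X j).2 := by simp [hq0]
      have t1 : ∀ᶠ s in 𝓝 (0:ℂ), q j s 2 ≠ 0 := h2.eventually_ne (by simp [e2])
      have t2 : ∀ᶠ s in 𝓝 (0:ℂ), (q j s 0 / q j s 2, q j s 1 / q j s 2) ∈ V (X j) := by
        have : ContinuousAt (fun s => (q j s 0 / q j s 2, q j s 1 / q j s 2)) 0 :=
          (h0.div h2 (by simp [e2])).prodMk (h1.div h2 (by simp [e2]))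
        have := tend_of_cont this (y := X j) (by simp [e0, e1, e2])
        exact this.eventually ((hV (X j)).2.mem_nhds (hV (X j)).1)
      have t3 : ∀ᶠ s in 𝓝 (0:ℂ), ‖q j s 0‖ < M * ‖q j s 2‖ := by
        refine Filter.Tendsto.eventually_lt (h0.norm) (h2.norm.const_mul M) ?_
        simpa [e0, e2] using hM j
      refine Filter.Eventually.filter_mono nhdsWithin_le_nhds ?_
      filter_upwards [t1, t2, t3] with s h1 h2 h3
      exact ⟨h1, h2, h3⟩
    · have hc : ContinuousAt (p k) 0 := (hp k).an.continuousAt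
      have h2 : ContinuousAt (fun s => p k s 2) 0 := by fun_prop
      have h0 : ContinuousAt (fun s => p k s 0) 0 := by fun_prop
      have e2 : p k 0 2 = 0 := by simp [hp0]
      have e0 : p k 0 0 = 1 := by simp [hp0]
      have t3 : ∀ᶠ s in 𝓝 (0:ℂ), M * ‖p k s 2‖ < ‖p k s 0‖ := by
        refine Filter.Tendsto.eventually_lt (h2.norm.const_mul M) (h0.norm) ?_
        simp [e0, e2]
      filter_upwards [t3.filter_mono nhdsWithin_le_nhds, hpW k] with s h1 h2
      exact ⟨h1, h2⟩
  · intro n hn hf hd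
    rcases hcl n hn hf hd with ⟨h2, h1⟩ | ⟨h2, j, hj⟩
    · simpa [h1, h2] using h0n n hn h2 h1
    · have := (hq j).L0
      rw [hq0, ← hj] at this
      simp only [mk3_0, mk3_1, mk3_2] at this
      intro h
      apply this
      field_simp
      rw [h, mul_zero]
  · intro n hn hf hd
    rcases hcl n hn hf hd with ⟨h2, h1⟩ | ⟨h2, j, hj⟩
    · refine cov_of_x l a b c _ n (h0n n hn h2 h1) ?_
      intro r hr
      rw [h1, h2, zero_div]
      filter_upwards [hpc r hr] with v hv h3 h4
      obtain ⟨i, s, hs⟩ := hv h3 h4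
      exact ⟨Sum.inr i, s, hs⟩
    · refine cov_of_z l a b c _ n h2 (Sum.inl j) ?_
      have := hqc j
      rw [← hj] at this
      exact this

lemma cubic_roots (m a b c : ℂ) (hm : m ≠ 0) (ha : a ≠ 0) (hc : c ≠ 0) (hb : b ^ 3 ≠ m * a * c ^ 2) :
    ∃ Y : Fin 3 → ℂ, Function.Injective Y ∧
      (∀ y, 2 * c * y ^ 3 - 3 * b * y ^ 2 + m * a = 0 ↔ ∃ i, y = Y i) ∧
      (∀ y, 2 * c * y ^ 3 - 3 * b * y ^ 2 + m * a = 0 → y ≠ 0 ∧ c * y - b ≠ 0) := by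
  have hz : ∀ y, 2 * c * y ^ 3 - 3 * b * y ^ 2 + m * a = 0 → y ≠ 0 ∧ c * y - b ≠ 0 := by
    intro y hy
    constructor
    · rintro rfl
      apply mul_ne_zero hm ha; linear_combination hy
    · intro h
      apply hb
      have : b = c * y := by linear_combination -h
      subst this
      linear_combination -c ^ 2 * hy
  let p : Polynomial ℂ := Polynomial.C (2 * c) * Polynomial.X ^ 3 + Polynomial.C (-3 * b) * Polynomial.X ^ 2
    + Polynomial.C 0 * Polynomial.X + Polynomial.C (m * a)
  have hdeg : p.natDegree = 3 := Polynomial.natDegree_cubic (by simp [hc])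
  have hp0 : p ≠ 0 := by intro h; rw [h] at hdeg; simp at hdeg
  have hev : ∀ y, p.eval y = 2 * c * y ^ 3 - 3 * b * y ^ 2 + m * a := by
    intro y; simp [p]; ring
  have hcard : p.roots.card = 3 := by
    rw [← hdeg]; exact (IsAlgClosed.splits p).natDegree_eq_card_roots.symm
  have hnd : p.roots.Nodup := by
    rw [Multiset.nodup_iff_count_le_one]
    intro y
    rw [Polynomial.count_roots]
    by_contra h
    push Not at h
    obtain ⟨h1, h2⟩ := (Polynomial.one_lt_rootMultiplicity_iff_isRoot hp0).1 h
    have h3 := hz y (by rw [← hev]; exact h1)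
    have h4 : p.derivative.eval y = 6 * y * (c * y - b) := by
      simp [p]; ring
    rw [Polynomial.IsRoot, h4] at h2
    simp [h3.1, h3.2] at h2
  have hfc : p.roots.toFinset.card = 3 := by
    rw [Multiset.toFinset_card_of_nodup hnd, hcard]
  let e := p.roots.toFinset.equivFinOfCardEq hfc
  refine ⟨fun i => (e.symm i : ℂ), ?_, ?_, hz⟩
  · exact Subtype.val_injective.comp e.symm.injective
  · intro y
    rw [← hev]
    constructor
    · intro h
      have : y ∈ p.roots.toFinset := by simp [hp0, h]
      exact ⟨e ⟨y, this⟩, by simp⟩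
    · rintro ⟨i, rfl⟩
      have := (e.symm i).2
      rw [Multiset.mem_toFinset, Polynomial.mem_roots hp0] at this
      exact this

lemma zcharts (l a b c : ℂ) (hl : l ≠ 0) (hl1 : l + 1 ≠ 0) (ha : a ≠ 0) (hc : c ≠ 0)
    (h1 : b ^ 3 ≠ 1 * a * c ^ 2) (h2 : b ^ 3 ≠ -l * a * c ^ 2)
    (hL1 : ∀ y, 2 * c * y ^ 3 - 3 * b * y ^ 2 + 1 * a = 0 → y ^ 3 + 1 * y + 1 ≠ 0)
    (hL2 : ∀ y, 2 * c * y ^ 3 - 3 * b * y ^ 2 + -l * a = 0 → y ^ 3 + -l * y + -l ≠ 0) :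
    ∃ (X : Option (Fin 3 ⊕ Fin 3) → ℂ × ℂ) (q : Option (Fin 3 ⊕ Fin 3) → ℂ → C3),
      Function.Injective X ∧ (∀ j, Br l a b c (q j)) ∧
      (∀ j, q j 0 = mk3 (X j).1 (X j).2 1) ∧ (∀ j, CovZ l a b c (q j) (X j).1 (X j).2) ∧
      (∀ n : C3, n ≠ 0 → fP l (n 0) (n 1) (n 2) = 0 → dP l a b c (n 0) (n 1) (n 2) = 0 →
      (n 2 = 0 ∧ n 1 = 0) ∨ (n 2 ≠ 0 ∧ ∃ j, (n 0 / n 2, n 1 / n 2) = X j)) := by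
  obtain ⟨Y, hYi, hY, hYn⟩ := cubic_roots 1 a b c one_ne_zero ha hc h1
  obtain ⟨T, hTi, hT, hTn⟩ := cubic_roots (-l) a b c (neg_ne_zero.2 hl) ha hc h2
  have eY : ∀ i, 2 * c * Y i ^ 3 - 3 * b * Y i ^ 2 + 1 * a = 0 := fun i => (hY _).2 ⟨i, rfl⟩
  have eT : ∀ i, 2 * c * T i ^ 3 - 3 * b * T i ^ 2 + -l * a = 0 := fun i => (hT _).2 ⟨i, rfl⟩
  have hll : l * l⁻¹ = 1 := mul_inv_cancel₀ hl
  have bY : ∀ i, ∃ q, Br l a b c q ∧ q 0 = mk3 (Y i ^ 3 * 1) (Y i) 1 ∧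
      CovZ l a b c q (Y i ^ 3 * 1) (Y i) := by
    intro i
    obtain ⟨n1, n2⟩ := hYn _ (eY i)
    refine branchA l a b c 1 (Y i) (-1) (-l) n1 (fun w => by ring) ?_ ?_ ?_ ?_
    · intro h; apply hl1; linear_combination -h
    · linear_combination -(l + 1) * eY i
    · have : 6 * b * Y i * (2 + (l - 1) * 1) + 6 * c * 1 * Y i ^ 2 * ((l - 1) - 2 * l * 1) =
        -6 * (l + 1) * Y i * (c * Y i - b) := by ring
      rw [this]
      exact mul_ne_zero (mul_ne_zero (mul_ne_zero (by norm_num) hl1) n1) n2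
    · intro h; apply hL1 _ (eY i); linear_combination h
  have bT : ∀ i, ∃ q, Br l a b c q ∧ q 0 = mk3 (T i ^ 3 * (-l⁻¹)) (T i) 1 ∧
      CovZ l a b c q (T i ^ 3 * (-l⁻¹)) (T i) := by
    intro i
    obtain ⟨n1, n2⟩ := hTn _ (eT i)
    refine branchA l a b c (-l⁻¹) (T i) l (-l) n1 (fun w => ?_) ?_ ?_ ?_ ?_
    · linear_combination (w - 1) * hll
    · intro h; apply hl1; linear_combination h - hll
    · field_simp
      linear_combination -(l + 1) * eT i
    · have : 6 * b * T i * (2 + (l - 1) * (-l⁻¹)) +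
          6 * c * (-l⁻¹) * T i ^ 2 * ((l - 1) - 2 * l * (-l⁻¹)) =
        -6 * (l + 1) * l⁻¹ * T i * (c * T i - b) := by field_simp; ring
      rw [this]
      exact mul_ne_zero (mul_ne_zero (mul_ne_zero (mul_ne_zero (by norm_num) hl1)
        (inv_ne_zero hl)) n1) n2
    · intro h; apply hL2 _ (eT i); field_simp at h; linear_combination -h
  choose qY hqY using bY
  choose qT hqT using bT
  obtain ⟨qB, hqB⟩ := branchB l a b c ha hl hl1
  refine ⟨fun j => j.elim (0, 0) (Sum.elim (fun i => (Y i ^ 3 * 1, Y i))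
    (fun i => (T i ^ 3 * (-l⁻¹), T i))), fun j => j.elim qB (Sum.elim qY qT), ?_, ?_, ?_, ?_, ?_⟩
  · have nY := fun i => (hYn _ (eY i)).1
    have nT := fun i => (hTn _ (eT i)).1
    have key : ∀ i j, Y i ^ 3 * 1 = T j ^ 3 * (-l⁻¹) → Y i = T j → False := by
      intro i j h e
      rw [e] at h
      have := mul_left_cancel₀ (pow_ne_zero _ (nT j)) h
      apply hl1; linear_combination l * this - hll
    rintro (_ | i | i) (_ | j | j) h <;>
      simp only [Option.elim, Sum.elim_inl, Sum.elim_inr, Prod.mk.injEq] at h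
    · rfl
    · exact absurd h.2.symm (nY j)
    · exact absurd h.2.symm (nT j)
    · exact absurd h.2 (nY i)
    · rw [hYi h.2]
    · exact (key i j h.1 h.2).elim
    · exact absurd h.2 (nT i)
    · exact (key j i h.1.symm h.2.symm).elim
    · rw [hTi h.2]
  · rintro (_ | i | i)
    exacts [hqB.1, (hqY i).1, (hqT i).1]
  · rintro (_ | i | i)
    exacts [hqB.2.1, (hqY i).2.1, (hqT i).2.1]
  · rintro (_ | i | i)
    exacts [hqB.2.2, (hqY i).2.2, (hqT i).2.2]
  · intro n hn hf hd
    by_cases hz : n 2 = 0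
    · left
      refine ⟨hz, ?_⟩
      rw [hz] at hf
      simp only [fP] at hf
      have : n 1 ^ 6 = 0 := by linear_combination hf
      exact pow_eq_zero_iff (by norm_num) |>.1 this
    · right
      refine ⟨hz, ?_⟩
      obtain ⟨x, hx⟩ : ∃ x, n 0 = n 2 * x := ⟨n 0 / n 2, by field_simp⟩
      obtain ⟨y, hy⟩ : ∃ y, n 1 = n 2 * y := ⟨n 1 / n 2, by field_simp⟩
      rw [hx, hy] at hf hd ⊢
      rw [mul_div_cancel_left₀ _ hz, mul_div_cancel_left₀ _ hz]
      have hf' : (y ^ 3 - x) * (y ^ 3 + l * x) = 0 := by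
        apply mul_left_cancel₀ (pow_ne_zero 6 hz)
        simp only [fP] at hf
        linear_combination hf
      have hd' : 3 * b * y ^ 2 * (2 * y ^ 3 + (l - 1) * x) +
          (a + 2 * c * x) * ((l - 1) * y ^ 3 - 2 * l * x) = 0 := by
        apply mul_left_cancel₀ (pow_ne_zero 5 hz)
        simp only [dP] at hd
        linear_combination hd
      by_cases hy0 : y = 0
      · refine ⟨none, ?_⟩
        subst hy0
        have : l * x ^ 2 = 0 := by linear_combination -hf'
        have : x = 0 := by simpa [hl] using this
        simp [this]
      rcases mul_eq_zero.1 hf' with h | h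
      · have hxx : x = y ^ 3 := by linear_combination -h
        have : 2 * c * y ^ 3 - 3 * b * y ^ 2 + 1 * a = 0 := by
          apply mul_left_cancel₀ (mul_ne_zero (pow_ne_zero 3 hy0) hl1)
          rw [hxx] at hd'
          linear_combination -hd'
        obtain ⟨i, hi⟩ := (hY y).1 this
        exact ⟨some (Sum.inl i), by simp [hxx, hi]⟩
      · have hxx : y ^ 3 = -l * x := by linear_combination h
        have hx0 : x ≠ 0 := by
          rintro rfl; apply hy0; simpa using hxx
        have : 2 * c * y ^ 3 - 3 * b * y ^ 2 + -l * a = 0 := by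
          apply mul_left_cancel₀ (mul_ne_zero hx0 hl1)
          rw [hxx] at hd' ⊢
          linear_combination hd'
        obtain ⟨i, hi⟩ := (hT y).1 this
        refine ⟨some (Sum.inr i), ?_⟩
        simp only [Option.elim, Sum.elim_inr, ← hi, hxx]
        congr 1; field_simp

open MvPolynomial in
def Pm (m : ℂ) : MvPolynomial (Fin 3) ℂ :=
  (X 1 ^ 3 - C m * X 0 * X 2 ^ 2) *
  (((Polynomial.X ^ 3 + Polynomial.C m * Polynomial.X + Polynomial.C m : Polynomial ℂ).roots.map
    (fun ρ => C (2 * ρ ^ 3) * X 2 - C (3 * ρ ^ 2) * X 1 + C m * X 0)).prod)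

lemma Pm_ne (m : ℂ) (hm : m ≠ 0) : Pm m ≠ 0 := by
  refine mul_ne_zero ?_ ?_
  · intro h
    have := congrArg (MvPolynomial.eval ![0, 1, 0]) h
    simp at this
  · rw [Ne, Multiset.prod_eq_zero_iff]
    intro h
    obtain ⟨ρ, -, h⟩ := Multiset.mem_map.1 h
    have := congrArg (MvPolynomial.eval ![1, 0, 0]) h
    simp [hm] at this

lemma Pm_ev (m a b c : ℂ) (h : MvPolynomial.eval ![a, b, c] (Pm m) ≠ 0) :
    b ^ 3 ≠ m * a * c ^ 2 ∧
    ∀ y, 2 * c * y ^ 3 - 3 * b * y ^ 2 + m * a = 0 → y ^ 3 + m * y + m ≠ 0 := by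
  rw [Pm, map_mul] at h
  obtain ⟨h1, h2⟩ := mul_ne_zero_iff.1 h
  constructor
  · intro e; apply h1; simp [e]
  · intro y hy h0
    apply h2
    rw [map_multiset_prod, Multiset.prod_eq_zero_iff, Multiset.map_map, Multiset.mem_map]
    refine ⟨y, ?_, ?_⟩
    · rw [Polynomial.mem_roots]
      · simpa using h0
      · intro h
        have := congrArg (fun p => Polynomial.coeff p 3) h
        simp [Polynomial.coeff_X] at this
    · simp; linear_combination hy


/-- For a generic linear projection (i.e. for `(a,b,c)` in a dense Zariski-open subset of
`ℂ³`, here the complement of the zero set of a nonzero polynomial), the polar curve of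
`(X₁,0)` has exactly 8 branches while the polar curve of `(X₂,0)` has exactly 9 branches:
for all sufficiently small `ε > 0`, `Π₁ ∩ {0 < ‖p‖ ≤ ε}` has exactly 8 connected
components and `Π₂ ∩ {0 < ‖p‖ ≤ ε}` has exactly 9. -/
theorem generic_polar_curves_have_8_and_9_branches :
    ∃ P : MvPolynomial (Fin 3) ℂ, P ≠ 0 ∧
      ∀ a b c : ℂ, MvPolynomial.eval ![a, b, c] P ≠ 0 →
        ∃ ε₀ > (0 : ℝ), ∀ ε : ℝ, 0 < ε → ε ≤ ε₀ →
          Nat.card (ConnectedComponents ↥(polarCurve FOne a b c ∩ puncturedBall ε)) = 8 ∧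
          Nat.card (ConnectedComponents ↥(polarCurve FTwo a b c ∩ puncturedBall ε)) = 9 := by
  refine ⟨MvPolynomial.X 0 * MvPolynomial.X 1 * MvPolynomial.X 2 * Pm 1 * Pm (-1) * Pm (-2), ?_, ?_⟩
  · have h := Pm_ne 1 (by norm_num)
    have h' := Pm_ne (-1) (by norm_num)
    have h'' := Pm_ne (-2) (by norm_num)
    simp [h, h', h'']
  intro a b c hP
  simp only [map_mul, MvPolynomial.eval_X, mul_ne_zero_iff] at hP
  obtain ⟨⟨⟨⟨⟨ha, hb⟩, hc⟩, hp1⟩, hp2⟩, hp3⟩ := hP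
  replace ha : a ≠ 0 := by simpa using ha
  replace hb : b ≠ 0 := by simpa using hb
  replace hc : c ≠ 0 := by simpa using hc
  have hp1 := Pm_ev _ _ _ _ hp1
  have hp2 := Pm_ev _ _ _ _ hp2
  have hp3 := Pm_ev _ _ _ _ hp3
  rw [polar_one, polar_two]
  have A1 : ∃ ε₀ > (0:ℝ), ∀ ε, 0 < ε → ε ≤ ε₀ →
      Nat.card (ConnectedComponents ↥(Pol 1 a b c ∩ puncturedBall ε)) = 8 := by
    obtain ⟨X, q, z1, z2, z3, z4, z5⟩ := zcharts 1 a b c (by norm_num) (by norm_num) ha hc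
      hp1.1 hp2.1 hp1.2 hp2.2
    obtain ⟨p, w1, w2, w3⟩ := branchC1 a b c hb hc
    have := assemble 1 a b c X z1 q z2 z3 z4 (fun _ : Unit => p) (fun _ => w1) (fun _ => w2)
      (fun _ => univ) (fun _ => isOpen_univ) (fun i j h => (h rfl).elim)
      (fun _ _ _ _ _ => mem_univ _) (fun _ => Eventually.of_forall fun _ => mem_univ _)
      (fun r hr => (w3 r hr).mono fun v hv h1 h2 => ⟨(), hv h1 h2⟩) z5
    simpa using this
  have A2 : ∃ ε₀ > (0:ℝ), ∀ ε, 0 < ε → ε ≤ ε₀ →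
      Nat.card (ConnectedComponents ↥(Pol 2 a b c ∩ puncturedBall ε)) = 9 := by
    obtain ⟨X, q, z1, z2, z3, z4, z5⟩ := zcharts 2 a b c (by norm_num) (by norm_num) ha hc
      hp1.1 hp3.1 hp1.2 hp3.2
    obtain ⟨p, w1, w2, w3, w4⟩ := branchD1 a b c hc
    obtain ⟨p', w1', w2', w3', w4'⟩ := branchD2 a b c hc
    have key : ∀ (p : C3) (t : ℂ), ‖(t • p) 1 ^ 3‖ = ‖t‖ ^ 3 * ‖p 1 ^ 3‖ ∧
        8 * ‖(t • p) 2 ^ 2 * (t • p) 0‖ = ‖t‖ ^ 3 * (8 * ‖p 2 ^ 2 * p 0‖) := by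
      intro p t
      simp only [PiLp.smul_apply, smul_eq_mul, norm_mul, norm_pow]
      constructor <;> ring
    have := assemble 2 a b c X z1 q z2 z3 z4 (fun k : Bool => bif k then p else p')
      (Bool.rec w1' w1) (Bool.rec w2' w2)
      (fun k => bif k then {p : C3 | 8 * ‖p 2 ^ 2 * p 0‖ < ‖p 1 ^ 3‖}
        else {p : C3 | ‖p 1 ^ 3‖ < 8 * ‖p 2 ^ 2 * p 0‖})
      (Bool.rec (isOpen_lt (by fun_prop) (by fun_prop)) (isOpen_lt (by fun_prop) (by fun_prop)))
      (by
        rintro (_ | _) (_ | _) h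
        · exact (h rfl).elim
        · rw [Set.disjoint_left]; intro p h1 h2
          have h3 : ‖p 1 ^ 3‖ < 8 * ‖p 2 ^ 2 * p 0‖ := h1
          exact lt_asymm h3 h2
        · rw [Set.disjoint_left]; intro p h1 h2
          have h3 : ‖p 1 ^ 3‖ < 8 * ‖p 2 ^ 2 * p 0‖ := h2
          exact lt_asymm h3 h1
        · exact (h rfl).elim)
      (by
        rintro (_ | _) p hp t ht
        · show ‖(t • p) 1 ^ 3‖ < 8 * ‖(t • p) 2 ^ 2 * (t • p) 0‖
          rw [(key p t).1, (key p t).2]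
          exact mul_lt_mul_of_pos_left hp (pow_pos (norm_pos_iff.2 ht) 3)
        · show 8 * ‖(t • p) 2 ^ 2 * (t • p) 0‖ < ‖(t • p) 1 ^ 3‖
          rw [(key p t).1, (key p t).2]
          exact mul_lt_mul_of_pos_left hp (pow_pos (norm_pos_iff.2 ht) 3))
      (Bool.rec w3' w3)
      (by
        intro r hr
        filter_upwards [w4 r hr, w4' r hr] with v h1 h2 hg hf
        rcases le_total (8 * ‖v.2 ^ 2‖) ‖v.1 ^ 3‖ with h | h
        · exact ⟨true, h1 hg hf h⟩
        · exact ⟨false, h2 hg hf h⟩) z5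
    simpa using this
  obtain ⟨e1, he1, H1⟩ := A1
  obtain ⟨e2, he2, H2⟩ := A2
  exact ⟨min e1 e2, lt_min he1 he2, fun ε h0 h => ⟨H1 ε h0 (h.trans (min_le_left _ _)),
    H2 ε h0 (h.trans (min_le_right _ _))⟩⟩
end
end

section
/- Let (X,0) be a superisolated surface singularity in (ℂ³,0) with projectivized tangent cone C ⊆ ℙ²(ℂ), and let Λ ⊆ ℂ³ be the union of the complex lines through 0 whose projective points are singular points of C, i.e. Λ = {λ·u : λ ∈ ℂ, u ∈ ℂ³ \ {0}, [u] ∈ Sing(C)}. Then for every ε > 0 there exist an open neighborhood U of 0 in ℂ³ and a constant K ≥ 1 such that for all p, q ∈ X ∩ U satisfying dist(p, Λ) ≥ ε·‖p‖ and dist(q, Λ) ≥ ε·‖q‖, the inner distance satisfies d_{X∩U}(p,q) ≤ K·‖p − q‖; i.e. the inner and outer metrics of (X,0) are bilipschitz equivalent on the conical part of X, outside cones around the exceptional lines. -/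
open scoped Topology ENNReal

noncomputable section

/-- Nonzero vectors `u ∈ ℂ³` representing singular points of the projective curve
`{f = 0}`: `f(u) = 0` and all three partial derivatives of `f` vanish at `u`. -/
def SingVec (f : MvPolynomial (Fin 3) ℂ) : Set (Fin 3 → ℂ) :=
  {u | u ≠ 0 ∧ MvPolynomial.eval u f = 0 ∧
    ∀ i : Fin 3, MvPolynomial.eval u (MvPolynomial.pderiv i f) = 0}

/-- `X` is a superisolated surface singularity with equation `f + g = 0`, where `f`, `g`
are homogeneous of degrees `d ≥ 2` and `d+1`, `f` is squarefree, and `{g = 0} ⊆ ℙ²`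
contains no singular point of the projectivized tangent cone `{f = 0}`. -/
def IsSIS (X : Set C3) (f g : MvPolynomial (Fin 3) ℂ) (d : ℕ) : Prop :=
  2 ≤ d ∧ f.IsHomogeneous d ∧ g.IsHomogeneous (d + 1) ∧ Squarefree f ∧
  X = {p : C3 | MvPolynomial.eval (fun i => p i) (f + g) = 0} ∧
  ∀ u ∈ SingVec f, MvPolynomial.eval u g ≠ 0

/-- The inner distance on `Y ⊆ ℂ³`: the infimum of lengths (total Euclidean variation)
of continuous paths in `Y` from `p` to `q`. -/
def innerDist (Y : Set C3) (p q : C3) : ℝ≥0∞ :=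
  sInf {L | ∃ γ : ℝ → C3, ContinuousOn γ (Set.Icc 0 1) ∧
    (∀ t ∈ Set.Icc (0 : ℝ) 1, γ t ∈ Y) ∧ γ 0 = p ∧ γ 1 = q ∧
    L = eVariationOn γ (Set.Icc 0 1)}

/-- The union `Λ ⊆ ℂ³` of the complex lines through `0` whose projective points are
singular points of the curve `{f = 0} ⊆ ℙ²(ℂ)`. -/
def exceptionalLines (f : MvPolynomial (Fin 3) ℂ) : Set C3 :=
  {v | ∃ (c : ℂ) (u : Fin 3 → ℂ), u ∈ SingVec f ∧ v = fun i => c * u i}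

def EF (f g : MvPolynomial (Fin 3) ℂ) (s : ℂ) (v : C3) : ℂ :=
  MvPolynomial.eval (fun i => v i) f + s * MvPolynomial.eval (fun i => v i) g

def Retr (f g : MvPolynomial (Fin 3) ℂ) (u : C3) (δ L ρ : ℝ) : Prop :=
  ∃ Φ : ℝ → C3 → C3, ∀ s ∈ Set.Icc 0 ρ, ∀ c ∈ Metric.ball u δ,
    EF f g s (Φ s c) = 0 ∧ (EF f g s c = 0 → Φ s c = c) ∧
    ∀ s' ∈ Set.Icc 0 ρ, ∀ c' ∈ Metric.ball u δ,
      ‖Φ s c - Φ s' c'‖ ≤ L * (|s - s'| + ‖c - c'‖)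

theorem eval_hasStrictFDerivAt (f : MvPolynomial (Fin 3) ℂ) (x : C3) :
    ∃ f' : C3 →L[ℂ] ℂ, HasStrictFDerivAt (fun v : C3 => MvPolynomial.eval (fun i => v i) f) f' x ∧
      ∀ i, f' (EuclideanSpace.single i 1) =
        MvPolynomial.eval (fun i => x i) (MvPolynomial.pderiv i f) := by
  induction f using MvPolynomial.induction_on with
  | C a =>
    refine ⟨0, ?_, by simp⟩
    simp only [MvPolynomial.eval_C]
    exact hasStrictFDerivAt_const _ _
  | add p q hp hq =>
    obtain ⟨p', hp, hp'⟩ := hp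
    obtain ⟨q', hq, hq'⟩ := hq
    refine ⟨p' + q', ?_, fun i => by simp [hp', hq']⟩
    simp only [map_add]
    exact hp.add hq
  | mul_X p j hp =>
    obtain ⟨p', hp, hp'⟩ := hp
    have hj : HasStrictFDerivAt (fun v : C3 => v j) (EuclideanSpace.proj j : C3 →L[ℂ] ℂ) x :=
      (EuclideanSpace.proj j : C3 →L[ℂ] ℂ).hasStrictFDerivAt
    have := hp.mul hj
    simp only [map_mul, MvPolynomial.eval_X]
    refine ⟨_, this, fun i => ?_⟩
    simp [MvPolynomial.pderiv_X, Pi.single_apply, hp']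
    by_cases h : i = j
    · subst h; simp
    · simp [h, Ne.symm h]; try ring

theorem EF_eval_smul (f : MvPolynomial (Fin 3) ℂ) (d : ℕ) (hf : f.IsHomogeneous d) (s : ℂ)
    (v : C3) : MvPolynomial.eval (fun i => (s • v) i) f
      = s ^ d * MvPolynomial.eval (fun i => v i) f := by
  rw [MvPolynomial.eval_eq, MvPolynomial.eval_eq, Finset.mul_sum]
  refine Finset.sum_congr rfl fun m hm => ?_
  have hd := hf (MvPolynomial.mem_support_iff.mp hm)
  have h2 : ∑ i ∈ m.support, m i = d := by
    rw [← hd]; simp [Finsupp.weight_apply, Finsupp.sum]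
  simp only [PiLp.smul_apply, smul_eq_mul, mul_pow, Finset.prod_mul_distrib,
    Finset.prod_pow_eq_pow_sum, h2]
  ring

theorem local_retr (f g : MvPolynomial (Fin 3) ℂ) (u₀ : C3)
    (h : MvPolynomial.eval (fun i => u₀ i) f ≠ 0 ∨
      ∃ i, MvPolynomial.eval (fun i => u₀ i) (MvPolynomial.pderiv i f) ≠ 0) :
    ∃ t ∈ 𝓝 u₀, ∃ δ > (0:ℝ), ∃ L ≥ (1 : ℝ), ∃ ρ > (0:ℝ), ∀ u ∈ t, ∀ s ∈ Set.Icc 0 ρ,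
      EF f g s u = 0 → Retr f g u δ L ρ := by
  by_cases h0 : MvPolynomial.eval (fun i => u₀ i) f = 0
  · obtain ⟨i, hi⟩ := h.resolve_left (not_not.mpr h0)
    let e : C3 := EuclideanSpace.single i 1
    let G : (ℂ × C3) × ℂ → ℂ := fun z => EF f g z.1.1 (z.1.2 + z.2 • e)
    let A : (ℂ × C3) × ℂ →L[ℂ] C3 :=
      (ContinuousLinearMap.snd ℂ ℂ C3).comp (ContinuousLinearMap.fst ℂ (ℂ × C3) ℂ) +
        (ContinuousLinearMap.snd ℂ (ℂ × C3) ℂ).smulRight e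
    have hA : ∀ z, A z = z.1.2 + z.2 • e := fun z => rfl
    have hA0 : A ((0, u₀), 0) = u₀ := by simp [hA]
    obtain ⟨f', hf1, hf2⟩ := eval_hasStrictFDerivAt f (A ((0, u₀), 0))
    obtain ⟨g', hg1, hg2⟩ := eval_hasStrictFDerivAt g (A ((0, u₀), 0))
    have h1 : HasStrictFDerivAt (fun z : (ℂ × C3) × ℂ =>
        MvPolynomial.eval (fun i => (A z) i) f) _ ((0, u₀), 0) :=
      HasStrictFDerivAt.comp (g := fun v : C3 => MvPolynomial.eval (fun i => v i) f) (f := A)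
        ((0, u₀), 0) hf1 A.hasStrictFDerivAt
    have h2 : HasStrictFDerivAt (fun z : (ℂ × C3) × ℂ =>
        MvPolynomial.eval (fun i => (A z) i) g) _ ((0, u₀), 0) :=
      HasStrictFDerivAt.comp (g := fun v : C3 => MvPolynomial.eval (fun i => v i) g) (f := A)
        ((0, u₀), 0) hg1 A.hasStrictFDerivAt
    have h3 : HasStrictFDerivAt (fun z : (ℂ × C3) × ℂ => z.1.1) _ ((0, u₀), 0) :=
      ((ContinuousLinearMap.fst ℂ ℂ C3).comp
        (ContinuousLinearMap.fst ℂ (ℂ × C3) ℂ)).hasStrictFDerivAt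
    obtain ⟨G', hG, hG'⟩ : ∃ G' : (ℂ × C3) × ℂ →L[ℂ] ℂ, HasStrictFDerivAt G G' ((0, u₀), 0) ∧
        G' (0, 1) = MvPolynomial.eval (fun i => u₀ i) (MvPolynomial.pderiv i f) := by
      refine ⟨_, h1.add (h3.mul h2), ?_⟩
      simp [hA, e, hf2]
    have hinv : (G' ∘L .inr ℂ (ℂ × C3) ℂ).IsInvertible := by
      have hval : (G' ∘L .inr ℂ (ℂ × C3) ℂ) = 
          ((ContinuousLinearEquiv.unitsEquivAut ℂ (Units.mk0 _ hi) : ℂ ≃L[ℂ] ℂ) : ℂ →L[ℂ] ℂ) := by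
        ext
        simp [hG']
      rw [hval]
      exact ⟨_, rfl⟩
    have hGu : G ((0, u₀), 0) = 0 := by simp [G, EF, h0]
    have e1 := hG.eventually_apply_eq_iff_implicitFunctionOfProdDomain hinv
    have e2 := hG.eventually_apply_implicitFunctionOfProdDomain hinv
    obtain ⟨K, t, ht, hK⟩ :=
      (hG.hasStrictFDerivAt_implicitFunctionOfProdDomain hinv).exists_lipschitzOnWith
    set ψ := hG.implicitFunctionOfProdDomain hinv
    rw [hGu] at e1 e2
    have e3 : ∀ᶠ z in 𝓝 ((0, u₀) : ℂ × C3), G (z, 0) = 0 ↔ ψ z = 0 := by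
      have : Filter.Tendsto (fun z : ℂ × C3 => (z, (0 : ℂ))) (𝓝 (0, u₀)) (𝓝 ((0, u₀), 0)) :=
        Continuous.tendsto (by fun_prop) _
      exact this.eventually e1
    obtain ⟨r, hr, hall⟩ := Metric.eventually_nhds_iff_ball.mp (e2.and (e3.and ht))
    refine ⟨Metric.ball u₀ (r / 2), Metric.ball_mem_nhds _ (by positivity), r / 2, by positivity,
      1 + K, by simp, r / 2, by positivity, fun u hu s _ _ => ?_⟩
    have hmem : ∀ s ∈ Set.Icc 0 (r / 2), ∀ c ∈ Metric.ball u (r / 2),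
        (((s : ℝ) : ℂ), c) ∈ Metric.ball ((0, u₀) : ℂ × C3) r := by
      intro s hs c hc
      rw [Metric.mem_ball, Prod.dist_eq, max_lt_iff]
      constructor
      · simp only [dist_zero_right, Complex.norm_real, Real.norm_eq_abs, abs_of_nonneg hs.1]
        linarith [hs.2]
      · have := dist_triangle c u u₀
        rw [Metric.mem_ball] at hc hu
        linarith
    refine ⟨fun s c => c + ψ (s, c) • e, fun s hs c hc => ?_⟩
    obtain ⟨a1, a2, a3⟩ := hall _ (hmem s hs c hc)
    refine ⟨a1, fun h => ?_, fun s' hs' c' hc' => ?_⟩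
    · have : ψ (s, c) = 0 := a2.mp (by simpa [G] using h)
      simp [this]
    · obtain ⟨b1, b2, b3⟩ := hall _ (hmem s' hs' c' hc')
      have hl := hK.dist_le_mul _ a3 _ b3
      have hd : dist (((s : ℝ) : ℂ), c) (((s' : ℝ) : ℂ), c') ≤ |s - s'| + ‖c - c'‖ := by
        rw [Prod.dist_eq]
        refine max_le ?_ ?_
        · rw [dist_eq_norm, ← Complex.ofReal_sub, Complex.norm_real, Real.norm_eq_abs]
          linarith [norm_nonneg (c - c')]
        · rw [dist_eq_norm]
          linarith [abs_nonneg (s - s')]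
      have he : ‖e‖ = 1 := by simp [e]
      have : (c + ψ (s, c) • e) - (c' + ψ (s', c') • e)
          = (c - c') + (ψ (s, c) - ψ (s', c')) • e := by
        rw [sub_smul]; abel
      rw [this]
      refine (norm_add_le _ _).trans ?_
      rw [norm_smul, he, mul_one, ← dist_eq_norm (ψ _)]
      have := mul_le_mul_of_nonneg_left hd K.2
      have := abs_nonneg (s - s')
      simp only [NNReal.val_eq_coe] at *
      linarith
  · have hc : ContinuousAt (fun z : ℂ × C3 => EF f g z.1 z.2) (0, u₀) := by
      have hf : Continuous fun v : C3 => MvPolynomial.eval (fun i => v i) f :=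
        continuous_iff_continuousAt.mpr fun x => (eval_hasStrictFDerivAt f x).choose_spec.1.continuousAt
      have hg : Continuous fun v : C3 => MvPolynomial.eval (fun i => v i) g :=
        continuous_iff_continuousAt.mpr fun x => (eval_hasStrictFDerivAt g x).choose_spec.1.continuousAt
      unfold EF
      exact Continuous.continuousAt
        ((hf.comp continuous_snd).add (continuous_fst.mul (hg.comp continuous_snd)))
    have hne := hc.eventually_ne (y := 0) (by simpa [EF] using h0)
    obtain ⟨r, hr, hall⟩ := Metric.eventually_nhds_iff_ball.mp hne
    refine ⟨Metric.ball u₀ r, Metric.ball_mem_nhds _ hr, 1, one_pos, 1, le_rfl, r / 2,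
      by positivity, fun u hu s hs h => ?_⟩
    refine absurd h (hall (s, u) ?_)
    rw [Metric.mem_ball, Prod.dist_eq, max_lt_iff]
    refine ⟨?_, hu⟩
    simp only [dist_zero_right, Complex.norm_real, Real.norm_eq_abs, abs_of_nonneg hs.1]
    linarith [hs.2]

theorem Retr.mono {f g : MvPolynomial (Fin 3) ℂ} {u : C3} {δ L ρ δ' L' ρ' : ℝ}
    (h : Retr f g u δ L ρ) (hδ : δ' ≤ δ) (hL : L ≤ L') (hρ : ρ' ≤ ρ) : Retr f g u δ' L' ρ' := by
  obtain ⟨Φ, hΦ⟩ := h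
  refine ⟨Φ, fun s hs c hc => ?_⟩
  obtain ⟨a, b, e⟩ := hΦ s ⟨hs.1, hs.2.trans hρ⟩ c (Metric.ball_subset_ball hδ hc)
  refine ⟨a, b, fun s' hs' c' hc' => ?_⟩
  refine (e s' ⟨hs'.1, hs'.2.trans hρ⟩ c' (Metric.ball_subset_ball hδ hc')).trans ?_
  gcongr

theorem unif_retr (f g : MvPolynomial (Fin 3) ℂ) (S : Set C3) (hS : IsCompact S)
    (h : ∀ u₀ ∈ S, MvPolynomial.eval (fun i => u₀ i) f ≠ 0 ∨
      ∃ i, MvPolynomial.eval (fun i => u₀ i) (MvPolynomial.pderiv i f) ≠ 0) :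
    ∃ δ > (0:ℝ), ∃ L ≥ (1 : ℝ), ∃ ρ > (0:ℝ), ∀ u ∈ S, ∀ s ∈ Set.Icc 0 ρ,
      EF f g s u = 0 → Retr f g u δ L ρ := by
  refine hS.induction_on (p := fun S => ∃ δ > (0:ℝ), ∃ L ≥ (1 : ℝ), ∃ ρ > (0:ℝ), ∀ u ∈ S,
    ∀ s ∈ Set.Icc 0 ρ, EF f g s u = 0 → Retr f g u δ L ρ) ?_ ?_ ?_ ?_
  · exact ⟨1, one_pos, 1, le_rfl, 1, one_pos, by simp⟩
  · rintro s t hst ⟨δ, hδ, L, hL, ρ, hρ, H⟩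
    exact ⟨δ, hδ, L, hL, ρ, hρ, fun u hu => H u (hst hu)⟩
  · rintro s t ⟨δ, hδ, L, hL, ρ, hρ, H⟩ ⟨δ', hδ', L', hL', ρ', hρ', H'⟩
    refine ⟨min δ δ', lt_min hδ hδ', max L L', le_max_of_le_left hL, min ρ ρ', lt_min hρ hρ', ?_⟩
    rintro u (hu | hu) s hs hE
    · exact (H u hu s ⟨hs.1, hs.2.trans (min_le_left _ _)⟩ hE).mono (min_le_left _ _)
        (le_max_left _ _) (min_le_left _ _)
    · exact (H' u hu s ⟨hs.1, hs.2.trans (min_le_right _ _)⟩ hE).mono (min_le_right _ _)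
        (le_max_right _ _) (min_le_right _ _)
  · intro x hx
    obtain ⟨t, ht, H⟩ := local_retr f g x (h x hx)
    exact ⟨t, mem_nhdsWithin_of_mem_nhds ht, H⟩

theorem innerDist_le_of_lip (Y : Set C3) (p q : C3) (γ : ℝ → C3) (K : ℝ) (hK : 0 ≤ K)
    (hl : ∀ t ∈ Set.Icc (0 : ℝ) 1, ∀ t' ∈ Set.Icc (0 : ℝ) 1, ‖γ t - γ t'‖ ≤ K * |t - t'|)
    (hY : ∀ t ∈ Set.Icc (0 : ℝ) 1, γ t ∈ Y) (h0 : γ 0 = p) (h1 : γ 1 = q) :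
    innerDist Y p q ≤ ENNReal.ofReal K := by
  have hL : LipschitzOnWith K.toNNReal γ (Set.Icc 0 1) := by
    refine LipschitzOnWith.of_dist_le_mul fun t ht t' ht' => ?_
    rw [dist_eq_norm, Real.dist_eq, Real.coe_toNNReal _ hK]
    exact hl t ht t' ht'
  have hle : innerDist Y p q ≤ eVariationOn γ (Set.Icc 0 1) :=
    sInf_le ⟨γ, hL.continuousOn, hY, h0, h1, rfl⟩
  refine hle.trans ?_
  have hid : eVariationOn (fun x : ℝ => x) (Set.Icc (0 : ℝ) 1) ≤ 1 := by
    have h := (monotoneOn_id (s := Set.Icc (0 : ℝ) 1)).eVariationOn_eq (a := 0) (b := 1)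
      (by simp) (by simp)
    rw [Set.inter_self] at h
    refine (le_of_eq h).trans ?_
    simp
  have := hL.comp_eVariationOn_le (g := fun x : ℝ => x) (s := Set.Icc 0 1) (fun x hx => hx)
  calc eVariationOn γ (Set.Icc 0 1) ≤ _ := this
    _ ≤ K.toNNReal * 1 := by gcongr
    _ = ENNReal.ofReal K := by rw [mul_one]; rfl

theorem smul_sub_smul_le (s s' : ℝ) (v v' : C3) :
    ‖(s : ℂ) • v - (s' : ℂ) • v'‖ ≤ |s - s'| * ‖v‖ + |s'| * ‖v - v'‖ := by
  have : (s : ℂ) • v - (s' : ℂ) • v' = ((s - s' : ℝ) : ℂ) • v + (s' : ℂ) • (v - v') := by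
    push_cast; rw [sub_smul, smul_sub]; abel
  rw [this]
  refine (norm_add_le _ _).trans ?_
  simp [norm_smul, ← Complex.ofReal_sub, -Complex.ofReal_sub]

theorem mem_of_EF {X : Set C3} {f g : MvPolynomial (Fin 3) ℂ} {d : ℕ} (hX : IsSIS X f g d)
    {s : ℂ} {v : C3} (h : EF f g s v = 0) : s • v ∈ X := by
  obtain ⟨-, hf, hg, -, rfl, -⟩ := hX
  simp only [Set.mem_ofPred_eq, map_add]
  rw [EF_eval_smul f d hf, EF_eval_smul g _ hg]
  unfold EF at h
  linear_combination s ^ d * h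

theorem EF_of_mem {X : Set C3} {f g : MvPolynomial (Fin 3) ℂ} {d : ℕ} (hX : IsSIS X f g d)
    {s : ℂ} (hs : s ≠ 0) {v : C3} (h : s • v ∈ X) : EF f g s v = 0 := by
  obtain ⟨-, hf, hg, -, rfl, -⟩ := hX
  simp only [Set.mem_ofPred_eq, map_add] at h
  rw [EF_eval_smul f d hf, EF_eval_smul g _ hg] at h
  unfold EF
  have : s ^ d ≠ 0 := pow_ne_zero _ hs
  apply mul_left_cancel₀ this
  linear_combination h

theorem cone_path {X : Set C3} {f g : MvPolynomial (Fin 3) ℂ} {d : ℕ} (hX : IsSIS X f g d)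
    {u : C3} {δ L ρ₀ ρ r : ℝ} (hδ : 0 < δ) (hL : 1 ≤ L) (hρ : ρ ≤ ρ₀) (hLρ : 4 * L * ρ ≤ 1)
    (hu : ‖u‖ = 1) (hR : Retr f g u δ L ρ₀) (hr : 0 < r) (hrρ : r < ρ) (hE : EF f g r u = 0) :
    ∃ a : ℝ → C3, a 0 = 0 ∧ a 1 = (r : ℂ) • u ∧
      (∀ t ∈ Set.Icc (0 : ℝ) 1, a t ∈ X ∩ Metric.ball 0 ρ) ∧
      ∀ t ∈ Set.Icc (0 : ℝ) 1, ∀ t' ∈ Set.Icc (0 : ℝ) 1, ‖a t - a t'‖ ≤ 3 * r * |t - t'| := by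
  obtain ⟨Φ, hΦ⟩ := hR
  have hub : u ∈ Metric.ball u δ := Metric.mem_ball_self hδ
  have hs : ∀ t ∈ Set.Icc (0 : ℝ) 1, t * r ∈ Set.Icc 0 ρ₀ := fun t ht =>
    ⟨mul_nonneg ht.1 hr.le, by nlinarith [ht.1, ht.2]⟩
  have hLr : L * r ≤ 1 := by nlinarith
  have h1 : Φ r u = u := by
    have := (hΦ (1 * r) (hs 1 (by simp)) u hub).2.1
    rw [one_mul] at this
    exact this hE
  have hlip : ∀ t ∈ Set.Icc (0 : ℝ) 1, ∀ t' ∈ Set.Icc (0 : ℝ) 1,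
      ‖Φ (t * r) u - Φ (t' * r) u‖ ≤ |t - t'| := by
    intro t ht t' ht'
    have := (hΦ _ (hs t ht) u hub).2.2 _ (hs t' ht') u hub
    rw [← sub_mul, abs_mul, abs_of_pos hr, sub_self, norm_zero, add_zero] at this
    nlinarith [abs_nonneg (t - t')]
  have hn : ∀ t ∈ Set.Icc (0 : ℝ) 1, ‖Φ (t * r) u‖ ≤ 1 + (1 - t) := by
    intro t ht
    have := hlip t ht 1 (by simp)
    rw [one_mul, h1, abs_sub_comm, abs_of_nonneg (by linarith [ht.2])] at this
    have h2 := norm_le_norm_add_norm_sub' (Φ (t * r) u) u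
    linarith
  refine ⟨fun t => ((t * r : ℝ) : ℂ) • Φ (t * r) u, by simp, by simp [h1], fun t ht => ⟨?_, ?_⟩, ?_⟩
  · exact mem_of_EF hX (hΦ _ (hs t ht) u hub).1
  · rw [mem_ball_zero_iff, norm_smul, Complex.norm_real, Real.norm_eq_abs, abs_of_nonneg (hs t ht).1]
    have := mul_le_mul_of_nonneg_left (hn t ht) (hs t ht).1
    nlinarith [mul_nonneg hr.le (sq_nonneg (1 - t))]
  · intro t ht t' ht'
    refine (smul_sub_smul_le _ _ _ _).trans ?_
    rw [← sub_mul, abs_mul, abs_of_pos hr, abs_of_nonneg (hs t' ht').1]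
    have a1 := hn t ht
    have a2 := hlip t ht t' ht'
    have a3 := abs_nonneg (t - t')
    have a4 : |t - t'| * r * ‖Φ (t * r) u‖ ≤ |t - t'| * r * 2 := by
      gcongr; linarith [ht.1]
    have a5 : t' * r * ‖Φ (t * r) u - Φ (t' * r) u‖ ≤ 1 * r * |t - t'| := by
      gcongr; exact ht'.2
    linarith

set_option maxHeartbeats 1000000 in
theorem near_path {X : Set C3} {f g : MvPolynomial (Fin 3) ℂ} {d : ℕ} (hX : IsSIS X f g d)
    {u₀ u₁ : C3} {δ L ρ₀ ρ r₀ r₁ D : ℝ} (hδ : 0 < δ) (hL : 1 ≤ L) (hρ : ρ ≤ ρ₀)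
    (hρ1 : ρ ≤ 1) (hLρ : 4 * L * ρ ≤ 1)
    (hu₀ : ‖u₀‖ = 1) (hu₁ : ‖u₁‖ = 1) (hR : Retr f g u₀ δ L ρ₀)
    (hr₀ : 0 < r₀) (hr₁ : 0 < r₁) (hrρ₀ : r₀ < ρ) (hrρ₁ : r₁ < ρ)
    (hE₀ : EF f g r₀ u₀ = 0) (hE₁ : EF f g r₁ u₁ = 0) (hD : 0 ≤ D)
    (hrD : |r₁ - r₀| ≤ D) (huD : ‖u₁ - u₀‖ ≤ 2 * D / r₀) (hDδ : 4 * D ≤ δ * r₀)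
    (hDL : 4 * L * D ≤ r₀) :
    innerDist (X ∩ Metric.ball 0 ρ) ((r₀ : ℂ) • u₀) ((r₁ : ℂ) • u₁) ≤
      ENNReal.ofReal ((2 + 44 * L) * D) := by
  obtain ⟨Φ, hΦ⟩ := hR
  obtain ⟨e, he⟩ : ∃ e, e = 2 * D / r₀ := ⟨_, rfl⟩
  obtain ⟨κ, hκ⟩ : ∃ κ, κ = 4 * L * e := ⟨_, rfl⟩
  obtain ⟨R, hRd⟩ : ∃ R, R = max r₀ r₁ := ⟨_, rfl⟩
  have her : e * r₀ = 2 * D := by rw [he]; field_simp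
  have he0 : 0 ≤ e := by rw [he]; positivity
  have hκ0 : 0 ≤ κ := by rw [hκ]; positivity
  rw [← he] at huD
  have hκ2 : κ ≤ 2 := by
    have : κ * r₀ ≤ 2 * r₀ := by rw [hκ]; linear_combination 2 * hDL + 4 * L * her
    exact le_of_mul_le_mul_right this hr₀
  have heδ : e < δ := by
    have : e * r₀ < δ * r₀ := by nlinarith
    exact lt_of_mul_lt_mul_right this hr₀.le
  have hRρ : R < ρ := by rw [hRd]; exact max_lt hrρ₀ hrρ₁
  have hR0 : r₀ ≤ R := by rw [hRd]; exact le_max_left _ _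
  have hR1 : r₁ ≤ R := by rw [hRd]; exact le_max_right _ _
  have hDr : D ≤ r₀ := by nlinarith
  have hRr : R ≤ 2 * r₀ := by
    rw [hRd]; refine max_le (by linarith) ?_
    linarith [le_abs_self (r₁ - r₀)]
  have hRpos : 0 < R := hr₀.trans_le hR0
  have hDe : D + κ * R ≤ 2 * e := by
    have h4 : 4 * L * R ≤ 1 := by nlinarith
    have h5 : κ * R ≤ e := by
      have := mul_le_mul_of_nonneg_right h4 he0
      rw [hκ]; linarith
    have h6 : e * r₀ ≤ e * 1 := by gcongr; linarith
    linarith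
  have hle3 : 3 * L * e ≤ κ := by
    have : 0 ≤ L * e := by positivity
    rw [hκ]; linarith
  let m : ℝ → ℝ := fun t => min t (1 - t)
  let l : ℝ → ℝ := fun t => r₀ + t * (r₁ - r₀)
  let s : ℝ → ℝ := fun t => (1 - κ * m t) * l t
  let c : ℝ → C3 := fun t => u₀ + (t : ℂ) • (u₁ - u₀)
  let v : ℝ → C3 := fun t => Φ (s t) (c t)
  have hm : ∀ t ∈ Set.Icc (0 : ℝ) 1, 0 ≤ m t ∧ m t ≤ 1 / 2 := by
    intro t ht
    refine ⟨le_min ht.1 (by linarith [ht.2]), ?_⟩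
    rcases le_total t (1 / 2) with h | h
    · exact (min_le_left _ _).trans h
    · exact (min_le_right _ _).trans (by linarith)
  have hκm : ∀ t ∈ Set.Icc (0 : ℝ) 1, 0 ≤ κ * m t ∧ κ * m t ≤ 1 := by
    intro t ht
    have := hm t ht
    exact ⟨mul_nonneg hκ0 this.1, by nlinarith⟩
  have hl : ∀ t ∈ Set.Icc (0 : ℝ) 1, 0 ≤ l t ∧ l t ≤ R := by
    intro t ht
    constructor
    · change 0 ≤ r₀ + t * (r₁ - r₀)
      nlinarith [mul_nonneg ht.1 hr₁.le, mul_nonneg (sub_nonneg.2 ht.2) hr₀.le]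
    · change r₀ + t * (r₁ - r₀) ≤ R
      nlinarith [mul_nonneg ht.1 (sub_nonneg.2 hR1), mul_nonneg (sub_nonneg.2 ht.2) (sub_nonneg.2 hR0)]
  have hs : ∀ t ∈ Set.Icc (0 : ℝ) 1, 0 ≤ s t ∧ s t ≤ (1 - κ * m t) * R := by
    intro t ht
    have h1 := hκm t ht
    have h2 := hl t ht
    exact ⟨mul_nonneg (by linarith) h2.1, mul_le_mul_of_nonneg_left h2.2 (by linarith)⟩
  have hsR : ∀ t ∈ Set.Icc (0 : ℝ) 1, s t ≤ R := by
    intro t ht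
    have h1 := hκm t ht
    have h2 := hs t ht
    nlinarith
  have hsI : ∀ t ∈ Set.Icc (0 : ℝ) 1, s t ∈ Set.Icc 0 ρ₀ := fun t ht =>
    ⟨(hs t ht).1, by linarith [hsR t ht]⟩
  have hmlip : ∀ t t' : ℝ, |m t - m t'| ≤ |t - t'| := by
    intro t t'
    refine (abs_min_sub_min_le_max t (1 - t) t' (1 - t')).trans (max_le le_rfl ?_)
    rw [show 1 - t - (1 - t') = -(t - t') by ring, abs_neg]
  have hslip : ∀ t ∈ Set.Icc (0 : ℝ) 1, ∀ t' ∈ Set.Icc (0 : ℝ) 1,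
      |s t - s t'| ≤ (D + κ * R) * |t - t'| := by
    intro t ht t' ht'
    have : s t - s t' = (1 - κ * m t) * ((t - t') * (r₁ - r₀)) - κ * (m t - m t') * l t' := by
      simp only [s, l]; ring
    rw [this]
    refine (abs_sub _ _).trans ?_
    rw [abs_mul, abs_mul, abs_mul, abs_mul, abs_of_nonneg hκ0, abs_of_nonneg (hl t' ht').1,
      abs_of_nonneg (by linarith [hκm t ht] : 0 ≤ 1 - κ * m t)]
    have b1 : (1 - κ * m t) * (|t - t'| * |r₁ - r₀|) ≤ 1 * (|t - t'| * D) := by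
      gcongr; linarith [hκm t ht]
    have b2 : κ * |m t - m t'| * l t' ≤ κ * |t - t'| * R := by
      have := (hl t' ht').1
      exact mul_le_mul (mul_le_mul_of_nonneg_left (hmlip t t') hκ0) (hl t' ht').2 this
        (by positivity)
    linarith
  have hclip : ∀ t t' : ℝ, ‖c t - c t'‖ ≤ e * |t - t'| := by
    intro t t'
    have : c t - c t' = ((t - t' : ℝ) : ℂ) • (u₁ - u₀) := by
      simp only [c]; push_cast; rw [sub_smul]; abel
    rw [this, norm_smul, Complex.norm_real, Real.norm_eq_abs, mul_comm]
    gcongr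
  have hcb : ∀ t ∈ Set.Icc (0 : ℝ) 1, c t ∈ Metric.ball u₀ δ := by
    intro t ht
    have h := hclip t 0
    have h0 : c 0 = u₀ := by simp [c]
    rw [h0, sub_zero, abs_of_nonneg ht.1] at h
    rw [mem_ball_iff_norm]
    nlinarith [ht.2]
  have hvlip : ∀ t ∈ Set.Icc (0 : ℝ) 1, ∀ t' ∈ Set.Icc (0 : ℝ) 1,
      ‖v t - v t'‖ ≤ 3 * L * e * |t - t'| := by
    intro t ht t' ht'
    refine ((hΦ _ (hsI t ht) _ (hcb t ht)).2.2 _ (hsI t' ht') _ (hcb t' ht')).trans ?_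
    have h1 := hslip t ht t' ht'
    have h2 := hclip t t'
    have h4 : |s t - s t'| + ‖c t - c t'‖ ≤ 3 * e * |t - t'| := by
      have := mul_le_mul_of_nonneg_right hDe (abs_nonneg (t - t'))
      linarith
    calc _ ≤ L * (3 * e * |t - t'|) := by gcongr
      _ = _ := by ring
  have i0 : (0 : ℝ) ∈ Set.Icc (0 : ℝ) 1 := by simp
  have i1 : (1 : ℝ) ∈ Set.Icc (0 : ℝ) 1 := by simp
  have hs0 : s 0 = r₀ := by simp [s, m, l]
  have hs1 : s 1 = r₁ := by simp [s, m, l]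
  have hc0 : c 0 = u₀ := by simp [c]
  have hc1 : c 1 = u₁ := by simp [c]
  have hv0 : v 0 = u₀ := by
    have := (hΦ _ (hsI 0 i0) _ (hcb 0 i0)).2.1
    rw [hs0, hc0] at this
    simp only [v, hs0, hc0]
    exact this hE₀
  have hv1 : v 1 = u₁ := by
    have := (hΦ _ (hsI 1 i1) _ (hcb 1 i1)).2.1
    rw [hs1, hc1] at this
    simp only [v, hs1, hc1]
    exact this hE₁
  have hvn : ∀ t ∈ Set.Icc (0 : ℝ) 1, ‖v t‖ ≤ 1 + κ * m t := by
    intro t ht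
    have h0 := hvlip t ht 0 i0
    have h1 := hvlip t ht 1 i1
    rw [hv0, sub_zero, abs_of_nonneg ht.1] at h0
    rw [hv1, abs_sub_comm, abs_of_nonneg (by linarith [ht.2])] at h1
    have h2 := norm_le_norm_add_norm_sub' (v t) u₀
    have h3 := norm_le_norm_add_norm_sub' (v t) u₁
    rcases min_choice t (1 - t) with h | h
    · simp only [m, h]
      linarith [mul_le_mul_of_nonneg_right hle3 ht.1]
    · simp only [m, h]
      linarith [mul_le_mul_of_nonneg_right hle3 (sub_nonneg.2 ht.2)]
  refine innerDist_le_of_lip _ _ _ (fun t => ((s t : ℝ) : ℂ) • v t) _ (by positivity) ?_ ?_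
    (by simp only [hs0, hv0]) (by simp only [hs1, hv1])
  · intro t ht t' ht'
    refine (smul_sub_smul_le _ _ _ _).trans ?_
    rw [abs_of_nonneg (hs t' ht').1]
    have h1 := hκm t ht
    have b1 : |s t - s t'| * ‖v t‖ ≤ ((D + κ * R) * |t - t'|) * 2 := by
      gcongr
      · exact hslip t ht t' ht'
      · linarith [hvn t ht]
    have b2 : s t' * ‖v t - v t'‖ ≤ R * (3 * L * e * |t - t'|) := by
      gcongr
      · exact hsR t' ht'
      · exact hvlip t ht t' ht'
    have hLe : L * e * R ≤ 4 * L * D := by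
      calc L * e * R ≤ L * e * (2 * r₀) := by gcongr
        _ = 4 * L * D := by linear_combination 2 * L * her
    have b3 : (D + κ * R) * 2 + R * (3 * L * e) ≤ (2 + 44 * L) * D := by
      rw [hκ]; linear_combination 11 * hLe
    have := mul_le_mul_of_nonneg_right b3 (abs_nonneg (t - t'))
    linarith
  · intro t ht
    refine ⟨mem_of_EF hX (hΦ _ (hsI t ht) _ (hcb t ht)).1, ?_⟩
    rw [mem_ball_zero_iff, norm_smul, Complex.norm_real, Real.norm_eq_abs, abs_of_nonneg (hs t ht).1]
    have h1 := hκm t ht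
    calc s t * ‖v t‖ ≤ ((1 - κ * m t) * R) * (1 + κ * m t) := by
          have := (hs t ht).1
          exact mul_le_mul (hs t ht).2 (hvn t ht) (norm_nonneg _) (this.trans (hs t ht).2)
      _ ≤ R := by nlinarith [mul_nonneg hRpos.le (sq_nonneg (κ * m t))]
      _ < ρ := hRρ

/-- On the conical part of a superisolated singularity `(X,0)`, i.e. outside cones around
the exceptional lines `Λ`, the inner and outer metrics are bilipschitz equivalent: for
every `ε > 0` there are a neighborhood `U` of `0` and `K ≥ 1` such that
`d_{X∩U}(p,q) ≤ K·‖p − q‖` whenever `p, q ∈ X ∩ U` satisfy `dist(p,Λ) ≥ ε‖p‖` and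
`dist(q,Λ) ≥ ε‖q‖`. -/
theorem inner_outer_bilipschitz_on_conical_part
    (X : Set C3) (f g : MvPolynomial (Fin 3) ℂ) (d : ℕ) (hX : IsSIS X f g d) :
    ∀ ε > (0 : ℝ), ∃ U : Set C3, IsOpen U ∧ (0 : C3) ∈ U ∧ ∃ K : ℝ, 1 ≤ K ∧
      ∀ p ∈ X ∩ U, ∀ q ∈ X ∩ U,
        ε * ‖p‖ ≤ Metric.infDist p (exceptionalLines f) →
        ε * ‖q‖ ≤ Metric.infDist q (exceptionalLines f) →
        innerDist (X ∩ U) p q ≤ ENNReal.ofReal (K * ‖p - q‖) := by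
  intro ε hε
  let S : Set C3 := {u | ‖u‖ = 1 ∧ ∀ y ∈ exceptionalLines f, ε ≤ dist u y}
  have hSc : IsCompact S := by
    refine (isCompact_sphere (0 : C3) 1).of_isClosed_subset ?_ fun u hu => by simpa using hu.1
    have : S = {u | ‖u‖ = 1} ∩ ⋂ y ∈ exceptionalLines f, {u | ε ≤ dist u y} := by
      ext u; simp [S]
    rw [this]
    refine (isClosed_eq continuous_norm continuous_const).inter ?_
    exact isClosed_biInter fun y _ => isClosed_le continuous_const (by fun_prop)
  have hS : ∀ u₀ ∈ S, MvPolynomial.eval (fun i => u₀ i) f ≠ 0 ∨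
      ∃ i, MvPolynomial.eval (fun i => u₀ i) (MvPolynomial.pderiv i f) ≠ 0 := by
    intro u hu
    by_contra! hcon
    have hmem : u ∈ exceptionalLines f := by
      refine ⟨1, fun i => u i, ⟨?_, hcon.1, hcon.2⟩, by simp⟩
      intro h0
      have : u = 0 := by ext i; exact congrFun h0 i
      have h1 := hu.1
      simp [this] at h1
    have := hu.2 u hmem
    rw [dist_self] at this
    linarith
  obtain ⟨δ, hδ, L, hL, ρ₀, hρ₀, H⟩ := unif_retr f g S hSc hS
  have hL0 : 0 < L := by linarith
  obtain ⟨ρ, hρ, hρ1, hρ2, hρ3⟩ : ∃ ρ > 0, ρ ≤ ρ₀ ∧ ρ ≤ 1 ∧ 4 * L * ρ ≤ 1 := by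
    refine ⟨min ρ₀ (min 1 (1 / (4 * L))), by positivity, min_le_left _ _,
      (min_le_right _ _).trans (min_le_left _ _), ?_⟩
    calc 4 * L * min ρ₀ (min 1 (1 / (4 * L))) ≤ 4 * L * (1 / (4 * L)) := by
          gcongr; exact (min_le_right _ _).trans (min_le_right _ _)
      _ = 1 := by field_simp
  obtain ⟨η, hη, hη1, hη2⟩ : ∃ η > 0, 4 * η ≤ δ ∧ 4 * L * η ≤ 1 := by
    refine ⟨min (δ / 4) (1 / (4 * L)), by positivity, ?_, ?_⟩
    · linarith [min_le_left (δ / 4) (1 / (4 * L))]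
    · calc 4 * L * min (δ / 4) (1 / (4 * L)) ≤ 4 * L * (1 / (4 * L)) := by
            gcongr; exact min_le_right _ _
        _ = 1 := by field_simp
  have hdec : ∀ p ∈ X ∩ Metric.ball 0 ρ, ε * ‖p‖ ≤ Metric.infDist p (exceptionalLines f) →
      p ≠ 0 → ∃ u, ‖u‖ = 1 ∧ p = ((‖p‖ : ℝ) : ℂ) • u ∧ EF f g ((‖p‖ : ℝ) : ℂ) u = 0 ∧
        Retr f g u δ L ρ₀ := by
    intro p hp hpe hp0
    have hn : 0 < ‖p‖ := norm_pos_iff.mpr hp0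
    have hnc : ((‖p‖ : ℝ) : ℂ) ≠ 0 := by exact_mod_cast hn.ne'
    have hpu : p = ((‖p‖ : ℝ) : ℂ) • (((‖p‖ : ℝ) : ℂ)⁻¹ • p) := by
      rw [smul_smul, mul_inv_cancel₀ hnc, one_smul]
    have hE : EF f g ((‖p‖ : ℝ) : ℂ) (((‖p‖ : ℝ) : ℂ)⁻¹ • p) = 0 := by
      apply EF_of_mem hX hnc
      rw [← hpu]; exact hp.1
    have hu1 : ‖((‖p‖ : ℝ) : ℂ)⁻¹ • p‖ = 1 := by
      rw [norm_smul, norm_inv, Complex.norm_real, norm_norm, inv_mul_cancel₀ hn.ne']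
    refine ⟨((‖p‖ : ℝ) : ℂ)⁻¹ • p, hu1, hpu, hE, ?_⟩
    refine H _ ⟨hu1, ?_⟩ ‖p‖ ⟨hn.le, ?_⟩ hE
    · rintro y ⟨c, w, hw, hy⟩
      have hmem : ((‖p‖ : ℝ) : ℂ) • y ∈ exceptionalLines f := by
        refine ⟨((‖p‖ : ℝ) : ℂ) * c, w, hw, ?_⟩
        ext i
        have := congrFun hy i
        simp only [PiLp.smul_apply, smul_eq_mul, mul_assoc]
        rw [← this]
      have h1 := hpe.trans (Metric.infDist_le_dist_of_mem hmem)
      nth_rewrite 2 [hpu] at h1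
      rw [dist_smul₀, Complex.norm_real, norm_norm, mul_comm] at h1
      exact le_of_mul_le_mul_left h1 hn
    · have := mem_ball_zero_iff.mp hp.2
      linarith
  have hcone : ∀ p ∈ X ∩ Metric.ball 0 ρ, ε * ‖p‖ ≤ Metric.infDist p (exceptionalLines f) →
      ∃ a : ℝ → C3, a 0 = 0 ∧ a 1 = p ∧
      (∀ t ∈ Set.Icc (0 : ℝ) 1, a t ∈ X ∩ Metric.ball 0 ρ) ∧
      ∀ t ∈ Set.Icc (0 : ℝ) 1, ∀ t' ∈ Set.Icc (0 : ℝ) 1,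
        ‖a t - a t'‖ ≤ 3 * ‖p‖ * |t - t'| := by
    intro p hp hpe
    by_cases hp0 : p = 0
    · subst hp0
      exact ⟨fun _ => 0, rfl, rfl, fun _ _ => hp, by simp⟩
    · obtain ⟨u, hu1, hpu, hE, hR⟩ := hdec p hp hpe hp0
      obtain ⟨a, a0, a1, a2, a3⟩ := cone_path hX hδ hL hρ1 hρ3 hu1 hR (norm_pos_iff.mpr hp0)
        (mem_ball_zero_iff.mp hp.2) hE
      exact ⟨a, a0, a1.trans hpu.symm, a2, a3⟩
  refine ⟨Metric.ball 0 ρ, Metric.isOpen_ball, Metric.mem_ball_self hρ,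
    (2 + 44 * L) + 6 * (2 / η + 1), ?_, ?_⟩
  · have : 0 < 2 / η := by positivity
    linarith
  intro p hp q hq hpe hqe
  have hqp : ‖q‖ ≤ ‖p‖ + ‖p - q‖ := by
    have := norm_sub_norm_le q p
    rw [norm_sub_rev] at this
    linarith
  have hD := norm_nonneg (p - q)
  by_cases hnear : p ≠ 0 ∧ q ≠ 0 ∧ ‖p - q‖ ≤ η * ‖p‖
  · obtain ⟨hp0, hq0, hn⟩ := hnear
    obtain ⟨u, hu1, hpu, hEu, hRu⟩ := hdec p hp hpe hp0
    obtain ⟨w, hw1, hqw, hEw, -⟩ := hdec q hq hqe hq0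
    have hpn := norm_pos_iff.mpr hp0
    have hqn := norm_pos_iff.mpr hq0
    have hrD : |‖q‖ - ‖p‖| ≤ ‖p - q‖ := by
      rw [abs_sub_comm]; exact abs_norm_sub_norm_le p q
    have hwu : ‖w - u‖ ≤ 2 * ‖p - q‖ / ‖p‖ := by
      rw [le_div_iff₀ hpn]
      have : ((‖p‖ : ℝ) : ℂ) • (w - u) = (q - p) + ((‖p‖ - ‖q‖ : ℝ) : ℂ) • w := by
        push_cast
        rw [smul_sub, sub_smul, ← hpu, ← hqw]; abel
      have h2 := congrArg norm this
      rw [norm_smul, Complex.norm_real, norm_norm] at h2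
      have h3 := norm_add_le (q - p) (((‖p‖ - ‖q‖ : ℝ) : ℂ) • w)
      rw [norm_smul, Complex.norm_real, hw1, mul_one, Real.norm_eq_abs, abs_sub_comm,
        norm_sub_rev] at h3
      rw [mul_comm, h2]
      linarith
    have := near_path hX hδ hL hρ1 hρ2 hρ3 hu1 hw1 hRu hpn hqn (mem_ball_zero_iff.mp hp.2)
      (mem_ball_zero_iff.mp hq.2) hEu hEw hD hrD hwu (by nlinarith) (by nlinarith)
    rw [← hpu, ← hqw] at this
    refine this.trans (ENNReal.ofReal_le_ofReal ?_)
    refine mul_le_mul_of_nonneg_right ?_ hD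
    have : 0 < 2 / η := by positivity
    linarith
  · have hfar : ‖p‖ + ‖q‖ ≤ (2 / η + 1) * ‖p - q‖ := by
      have h1 : ‖p‖ ≤ (1 / η + 1) * ‖p - q‖ ∧ ‖p‖ + ‖q‖ ≤ (2 / η + 1) * ‖p - q‖ := by
        have hη0 : 0 < 1 / η := by positivity
        have e2 : 2 / η = 2 * (1 / η) := by ring
        by_cases hp0 : p = 0
        · subst hp0
          simp only [norm_zero, zero_sub, norm_neg, zero_add]
          constructor
          · positivity
          · rw [e2]; nlinarith [norm_nonneg q]
        by_cases hq0 : q = 0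
        · subst hq0
          simp only [norm_zero, sub_zero, add_zero]
          rw [e2]; constructor <;> nlinarith [norm_nonneg p]
        have hlt : η * ‖p‖ < ‖p - q‖ := by
          by_contra! h
          exact hnear ⟨hp0, hq0, h⟩
        have : ‖p‖ ≤ 1 / η * ‖p - q‖ := by
          rw [one_div, inv_mul_eq_div, le_div_iff₀ hη]; linarith
        constructor
        · linarith
        · rw [e2]; linarith
      exact h1.2
    obtain ⟨a, a0, a1, a2, a3⟩ := hcone p hp hpe
    obtain ⟨b, b0, b1, b2, b3⟩ := hcone q hq hqe
    refine (innerDist_le_of_lip _ _ _ (fun t => a (max (1 - 2 * t) 0) + b (max (2 * t - 1) 0))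
      (6 * (‖p‖ + ‖q‖)) (by positivity) ?_ ?_ ?_ ?_).trans (ENNReal.ofReal_le_ofReal ?_)
    · intro t ht t' ht'
      have i1 : ∀ t ∈ Set.Icc (0 : ℝ) 1, max (1 - 2 * t) 0 ∈ Set.Icc (0 : ℝ) 1 := fun t ht =>
        ⟨le_max_right _ _, max_le (by linarith [ht.1]) zero_le_one⟩
      have i2 : ∀ t ∈ Set.Icc (0 : ℝ) 1, max (2 * t - 1) 0 ∈ Set.Icc (0 : ℝ) 1 := fun t ht =>
        ⟨le_max_right _ _, max_le (by linarith [ht.2]) zero_le_one⟩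
      have j1 := a3 _ (i1 t ht) _ (i1 t' ht')
      have j2 := b3 _ (i2 t ht) _ (i2 t' ht')
      have k1 : |max (1 - 2 * t) 0 - max (1 - 2 * t') 0| ≤ 2 * |t - t'| := by
        refine (abs_max_sub_max_le_abs _ _ _).trans ?_
        rw [show 1 - 2 * t - (1 - 2 * t') = -(2 * (t - t')) by ring, abs_neg, abs_mul, abs_two]
      have k2 : |max (2 * t - 1) 0 - max (2 * t' - 1) 0| ≤ 2 * |t - t'| := by
        refine (abs_max_sub_max_le_abs _ _ _).trans ?_
        rw [show 2 * t - 1 - (2 * t' - 1) = (2 * (t - t')) by ring, abs_mul, abs_two]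
      have l1 := mul_le_mul_of_nonneg_left k1 (by positivity : 0 ≤ 3 * ‖p‖)
      have l2 := mul_le_mul_of_nonneg_left k2 (by positivity : 0 ≤ 3 * ‖q‖)
      rw [show ∀ x y z w : C3, x + y - (z + w) = x - z + (y - w) from fun x y z w => by abel]
      refine (norm_add_le _ _).trans ?_
      linarith
    · intro t ht
      beta_reduce
      rcases le_total t (1 / 2) with h | h
      · rw [max_eq_right (by linarith : 2 * t - 1 ≤ 0), b0, add_zero]
        exact a2 _ ⟨le_max_right _ _, max_le (by linarith [ht.1]) zero_le_one⟩
      · rw [max_eq_right (by linarith : 1 - 2 * t ≤ 0), a0, zero_add]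
        exact b2 _ ⟨le_max_right _ _, max_le (by linarith [ht.2]) zero_le_one⟩
    · norm_num [a1, b0]
    · norm_num [a0, b1]
    · have : 0 ≤ (2 + 44 * L) * ‖p - q‖ := by positivity
      linarith
end
end
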